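/- Let γ be a probability measure on ℝ³ that is the weak limit, as n → ∞, of the measures ν_n^0. Then for every real ν > 0 and every Schwartz function f : ℝ³ → ℝ, Ent_γ(f²) ≤ 2ν(e^{1/ν} − 1) ∫_{ℝ³} ( (∂_x f)² + (∂_y f)² + ( ν + (x²+y²)/4 )(∂_z f)² ) dγ(x,y,z). -/

import Mathlib

open MeasureTheory ProbabilityTheory

noncomputable section

/-- The Heisenberg group as ℝ³. -/
abbrev H : Type := ℝ × ℝ × ℝ

/-- Entropy of `f` with respect to `μ`. -/
def Ent {α : Type*} [MeasurableSpace α] (μ : Measure α) (f : α → ℝ) : ℝ :=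
  ∫ a, f a * Real.log (f a) ∂μ - (∫ a, f a ∂μ) * Real.log (∫ a, f a ∂μ)

/-- Partial derivative in the first coordinate. -/
def pdx (f : H → ℝ) (p : H) : ℝ := deriv (fun t => f (t, p.2.1, p.2.2)) p.1

/-- Partial derivative in the second coordinate. -/
def pdy (f : H → ℝ) (p : H) : ℝ := deriv (fun t => f (p.1, t, p.2.2)) p.2.1

/-- Partial derivative in the third coordinate. -/
def pdz (f : H → ℝ) (p : H) : ℝ := deriv (fun t => f (p.1, p.2.1, t)) p.2.2

/-- The standard Gaussian measure on ℝ³. -/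
def stdGauss3 : Measure H :=
  (gaussianReal 0 1).prod ((gaussianReal 0 1).prod (gaussianReal 0 1))

/-- The standard Gaussian measure N(0, I_{3n}) on (ℝ³)^n. -/
def gaussN (n : ℕ) : Measure (Fin n → H) := Measure.pi fun _ => stdGauss3

/-- `s_{n,k}^β` : the `k`-th step of the Heisenberg random walk built from `n` increments. -/
def snk (β : ℝ) (n k : ℕ) (v : Fin n → H) : H :=
  ((n : ℝ) ^ (-(1:ℝ)/2) * ∑ i : Fin n, (if i.val < k then (v i).1 else 0),
   (n : ℝ) ^ (-(1:ℝ)/2) * ∑ i : Fin n, (if i.val < k then (v i).2.1 else 0),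
   β * (n : ℝ) ^ (-(1:ℝ)/2) * ∑ i : Fin n, (if i.val < k then (v i).2.2 else 0)
     + (2 * (n : ℝ))⁻¹ * ∑ i : Fin n, ∑ j : Fin n,
        (if i.val < j.val ∧ j.val < k then
          (v i).1 * (v j).2.1 - (v i).2.1 * (v j).1 else 0))

/-- `ν_n^β` : the law of the Heisenberg random walk at its `n`-th step. -/
def nuMeas (β : ℝ) (n : ℕ) : Measure H := (gaussN n).map (snk β n n)

/-! ### Gaussian moments, integration by parts and the Poincaré inequality -/

section Gaussian

/-- The weight `1 + ‖ξ‖` has moments of all orders under a Gaussian measure. -/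
lemma integrable_one_add_norm_pow {E : Type*} [NormedAddCommGroup E] [NormedSpace ℝ E]
    [CompleteSpace E] [SecondCountableTopology E] [MeasurableSpace E] [BorelSpace E]
    (μ : Measure E) [IsGaussian μ] (k : ℕ) : Integrable (fun ξ => (1 + ‖ξ‖) ^ k) μ := by
  have h : MemLp (fun ξ : E => 1 + ‖ξ‖) k μ :=
    (memLp_const (1 : ℝ)).add (IsGaussian.memLp_id μ k (by simp)).norm
  have h2 := h.integrable_norm_pow'
  refine h2.congr (Filter.Eventually.of_forall fun ξ => ?_)
  have : 0 ≤ 1 + ‖ξ‖ := by positivity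
  simp only [Real.norm_of_nonneg this]

/-- Functions of polynomial growth are integrable under a Gaussian measure. -/
lemma integrable_of_abs_le_pow {E : Type*} [NormedAddCommGroup E] [NormedSpace ℝ E]
    [CompleteSpace E] [SecondCountableTopology E] [MeasurableSpace E] [BorelSpace E]
    {μ : Measure E} [IsGaussian μ] {F : E → ℝ} (hF : Measurable F) (k : ℕ) (C : ℝ)
    (h : ∀ ξ, |F ξ| ≤ C * (1 + ‖ξ‖) ^ k) : Integrable F μ :=
  ((integrable_one_add_norm_pow μ k).const_mul C).mono' hF.aestronglyMeasurable
    (Filter.Eventually.of_forall h)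

/-- Gaussian integration by parts. -/
lemma integral_id_mul_gaussianReal {φ φ' : ℝ → ℝ} {C : ℝ} (hφ : ∀ x, HasDerivAt φ (φ' x) x)
    (hφ' : Continuous φ') (hC : ∀ x, |φ x| ≤ C) (hC' : ∀ x, |φ' x| ≤ C) :
    ∫ x, x * φ x ∂(gaussianReal 0 1) = ∫ x, φ' x ∂(gaussianReal 0 1) := by
  have hcont : Continuous φ := continuous_iff_continuousAt.2 fun x => (hφ x).continuousAt
  have hC0 : 0 ≤ C := (abs_nonneg _).trans (hC 0)
  have key : ∀ F : ℝ → ℝ, Integrable F (gaussianReal 0 1) →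
      Integrable (fun x => gaussianPDFReal 0 1 x * F x) := by
    intro F hF
    rw [gaussianReal_of_var_ne_zero _ one_ne_zero] at hF
    have := (integrable_withDensity_iff_integrable_smul' (measurable_gaussianPDF 0 1)
      (Filter.Eventually.of_forall fun _ => gaussianPDF_lt_top)).1 hF
    simpa [toReal_gaussianPDF, smul_eq_mul] using this
  have hder : ∀ x, HasDerivAt (gaussianPDFReal 0 1) (-x * gaussianPDFReal 0 1 x) x := by
    intro x
    have h1 : HasDerivAt (fun y : ℝ => -(y - 0) ^ 2 / (2 * ((1 : NNReal) : ℝ))) (-x) x := by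
      have := (((hasDerivAt_id x).sub_const 0).pow 2).neg.div_const (2 * ((1 : NNReal) : ℝ))
      refine this.congr_deriv ?_
      simp only [id_eq, sub_zero, NNReal.coe_one]
      norm_num
      ring
    have := h1.exp.const_mul ((√(2 * Real.pi * (1 : NNReal)))⁻¹)
    refine this.congr_deriv ?_
    rw [gaussianPDFReal_def]; ring
  have i1 : Integrable (fun x => x * φ x) (gaussianReal 0 1) := by
    refine integrable_of_abs_le_pow (by fun_prop) 1 C fun x => ?_
    rw [abs_mul, pow_one, mul_comm]
    have := hC x
    gcongr
    simp
  have i2 : Integrable φ (gaussianReal 0 1) :=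
    integrable_of_abs_le_pow (by fun_prop) 0 C (by simpa using hC)
  have i3 : Integrable φ' (gaussianReal 0 1) :=
    integrable_of_abs_le_pow (by fun_prop) 0 C (by simpa using hC')
  have ibp := integral_mul_deriv_eq_deriv_mul_of_integrable (u := gaussianPDFReal 0 1) (v := φ)
    (u' := fun x => -x * gaussianPDFReal 0 1 x) (v' := φ') (fun x _ => hder x) (fun x _ => hφ x)
    (key _ i3) ((key _ i1).neg.congr (Filter.Eventually.of_forall fun x => by
      simp only [Pi.neg_apply, Pi.mul_apply]; ring)) (key _ i2)
  rw [integral_gaussianReal_eq_integral_smul one_ne_zero,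
    integral_gaussianReal_eq_integral_smul one_ne_zero]
  simp only [smul_eq_mul]
  rw [ibp, ← integral_neg]
  congr 1; ext x; ring

/-- Invariance of the planar Gaussian measure under rotations. -/
lemma integral_rotation_gaussianReal (θ : ℝ) (F : ℝ × ℝ → ℝ) (hF : Measurable F) :
    ∫ p, F (Real.cos θ * p.1 + Real.sin θ * p.2, -Real.sin θ * p.1 + Real.cos θ * p.2)
      ∂((gaussianReal 0 1).prod (gaussianReal 0 1))
      = ∫ p, F p ∂((gaussianReal 0 1).prod (gaussianReal 0 1)) := by
  have h := IsGaussian.map_rotation_eq_self (μ := gaussianReal 0 1) (by simp) θ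
  conv_rhs => rw [← h]
  rw [integral_map (by fun_prop) hF.aestronglyMeasurable]
  rfl

/-- The Gaussian Poincaré inequality on the line. -/
lemma gaussianReal_poincare {φ φ' : ℝ → ℝ} {C : ℝ} (hφ : ∀ x, HasDerivAt φ (φ' x) x)
    (hφ' : Continuous φ') (hC : ∀ x, |φ x| ≤ C) (hC' : ∀ x, |φ' x| ≤ C) :
    ∫ x, φ x ^ 2 ∂(gaussianReal 0 1) - (∫ x, φ x ∂(gaussianReal 0 1)) ^ 2
      ≤ ∫ x, φ' x ^ 2 ∂(gaussianReal 0 1) := by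
  have hcont : Continuous φ := continuous_iff_continuousAt.2 fun x => (hφ x).continuousAt
  have hC0 : 0 ≤ C := (abs_nonneg _).trans (hC 0)
  set μ : Measure ℝ := gaussianReal 0 1 with hμ
  have absmul : ∀ {u v a b : ℝ}, |u| ≤ a → |v| ≤ b → |u * v| ≤ a * b := by
    intro u v a b hu hv
    rw [abs_mul]; exact mul_le_mul hu hv (abs_nonneg _) ((abs_nonneg _).trans hu)
  set F : ℝ → ℝ := fun θ => ∫ p, φ p.1 * φ (Real.cos θ * p.1 + Real.sin θ * p.2) ∂(μ.prod μ)
    with hFdef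
  have hder : ∀ θ, HasDerivAt F (∫ p, φ p.1 * (φ' (Real.cos θ * p.1 + Real.sin θ * p.2) *
      (-Real.sin θ * p.1 + Real.cos θ * p.2)) ∂(μ.prod μ)) θ := by
    intro θ
    refine (hasDerivAt_integral_of_dominated_loc_of_deriv_le
      (F := fun θ (p : ℝ × ℝ) => φ p.1 * φ (Real.cos θ * p.1 + Real.sin θ * p.2))
      (F' := fun θ (p : ℝ × ℝ) => φ p.1 * (φ' (Real.cos θ * p.1 + Real.sin θ * p.2) *
        (-Real.sin θ * p.1 + Real.cos θ * p.2)))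
      (bound := fun p => (C * (C * 2)) * (1 + ‖p‖) ^ 1) Filter.univ_mem ?_ ?_ ?_ ?_ ?_ ?_).2
    · exact Filter.Eventually.of_forall fun t =>
        (by fun_prop : Continuous _).aestronglyMeasurable
    · refine integrable_of_abs_le_pow (by fun_prop) 0 (C * C) fun p => ?_
      rw [pow_zero, mul_one]
      exact absmul (hC _) (hC _)
    · exact (by fun_prop : Continuous _).aestronglyMeasurable
    · refine Filter.Eventually.of_forall fun p t _ => ?_
      rw [Real.norm_eq_abs, pow_one, mul_assoc, mul_assoc C 2]
      refine absmul (hC _) (absmul (hC' _) ?_)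
      have h1 := norm_fst_le p
      have h2 := norm_snd_le p
      rw [Real.norm_eq_abs] at h1 h2
      have h3 : |-Real.sin t * p.1| ≤ 1 * ‖p‖ :=
        absmul (by rw [abs_neg]; exact Real.abs_sin_le_one t) h1
      have h4 : |Real.cos t * p.2| ≤ 1 * ‖p‖ := absmul (Real.abs_cos_le_one t) h2
      have := abs_add_le (-Real.sin t * p.1) (Real.cos t * p.2)
      linarith
    · exact (integrable_one_add_norm_pow _ 1).const_mul _
    · refine Filter.Eventually.of_forall fun p t _ => ?_
      have hin : HasDerivAt (fun t => Real.cos t * p.1 + Real.sin t * p.2)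
          (-Real.sin t * p.1 + Real.cos t * p.2) t :=
        ((Real.hasDerivAt_cos t).mul_const _).add ((Real.hasDerivAt_sin t).mul_const _)
      exact ((hφ _).comp t hin).const_mul _
  have hrot : ∀ θ, ∫ p, φ p.1 * (φ' (Real.cos θ * p.1 + Real.sin θ * p.2) *
      (-Real.sin θ * p.1 + Real.cos θ * p.2)) ∂(μ.prod μ) =
      -Real.sin θ * ∫ p, φ' p.1 * φ' (Real.cos θ * p.1 - Real.sin θ * p.2) ∂(μ.prod μ) := by
    intro θ
    have h1 := integral_rotation_gaussianReal θ
      (fun q => φ (Real.cos θ * q.1 - Real.sin θ * q.2) * (φ' q.1 * q.2)) (by fun_prop)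
    have h2 : ∫ p, φ p.1 * (φ' (Real.cos θ * p.1 + Real.sin θ * p.2) *
        (-Real.sin θ * p.1 + Real.cos θ * p.2)) ∂(μ.prod μ)
        = ∫ q, φ (Real.cos θ * q.1 - Real.sin θ * q.2) * (φ' q.1 * q.2) ∂(μ.prod μ) := by
      rw [← h1]
      refine integral_congr_ae (Filter.Eventually.of_forall fun p => ?_)
      have : Real.cos θ * (Real.cos θ * p.1 + Real.sin θ * p.2) -
          Real.sin θ * (-Real.sin θ * p.1 + Real.cos θ * p.2) = p.1 := by
        linear_combination p.1 * Real.sin_sq_add_cos_sq θ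
      simp only [this]
    rw [h2, integral_prod, ← integral_const_mul, integral_prod]
    · congr 1; ext u
      have hs := integral_id_mul_gaussianReal
        (φ := fun v => φ (Real.cos θ * u - Real.sin θ * v))
        (φ' := fun v => φ' (Real.cos θ * u - Real.sin θ * v) * (-Real.sin θ)) (C := C)
        (fun v => by
          have hin : HasDerivAt (fun v => Real.cos θ * u - Real.sin θ * v) (-Real.sin θ) v := by
            simpa using ((hasDerivAt_id v).const_mul (Real.sin θ)).const_sub (Real.cos θ * u)
          exact (hφ _).comp v hin)
        (by fun_prop) (fun v => hC _) (fun v => by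
          have := absmul (hC' (Real.cos θ * u - Real.sin θ * v))
            (show |-Real.sin θ| ≤ 1 by rw [abs_neg]; exact Real.abs_sin_le_one θ)
          simpa using this)
      calc ∫ v, φ (Real.cos θ * u - Real.sin θ * v) * (φ' u * v) ∂μ
          = φ' u * ∫ v, v * φ (Real.cos θ * u - Real.sin θ * v) ∂μ := by
            rw [← integral_const_mul]; congr 1; ext v; ring
        _ = φ' u * ∫ v, φ' (Real.cos θ * u - Real.sin θ * v) * (-Real.sin θ) ∂μ := by rw [hs]
        _ = _ := by rw [← integral_const_mul]; congr 1; ext v; ring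
    · refine integrable_of_abs_le_pow (by fun_prop) 0 (C * C) fun p => ?_
      have h3 := absmul (show |-Real.sin θ| ≤ 1 by rw [abs_neg]; exact Real.abs_sin_le_one θ)
        (absmul (hC' p.1) (hC' (Real.cos θ * p.1 - Real.sin θ * p.2)))
      simpa using h3
    · refine integrable_of_abs_le_pow (by fun_prop) 1 (C * C) fun p => ?_
      have h1 : |p.2| ≤ 1 + ‖p‖ := by
        have := norm_snd_le p
        rw [Real.norm_eq_abs] at this; linarith
      have := absmul (hC (Real.cos θ * p.1 - Real.sin θ * p.2)) (absmul (hC' p.1) h1)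
      rw [pow_one]; linarith
  have isq : Integrable (fun x => φ' x ^ 2) μ := by
    refine integrable_of_abs_le_pow (by fun_prop) 0 (C * C) fun p => ?_
    rw [pow_zero, mul_one, pow_two]; exact absmul (hC' _) (hC' _)
  have hcs : ∀ θ, ∫ p, φ' p.1 * φ' (Real.cos θ * p.1 - Real.sin θ * p.2) ∂(μ.prod μ)
      ≤ ∫ x, φ' x ^ 2 ∂μ := by
    intro θ
    have e1 : ∫ p : ℝ × ℝ, φ' p.1 ^ 2 ∂(μ.prod μ) = ∫ x, φ' x ^ 2 ∂μ := by
      simpa using integral_fun_fst (μ := μ) (ν := μ) (fun x => φ' x ^ 2)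
    have e2 : ∫ p : ℝ × ℝ, φ' (Real.cos θ * p.1 - Real.sin θ * p.2) ^ 2 ∂(μ.prod μ)
        = ∫ x, φ' x ^ 2 ∂μ := by
      rw [← e1]
      have := integral_rotation_gaussianReal (-θ) (fun q => φ' q.1 ^ 2) (by fun_prop)
      rw [← this]
      simp [sub_eq_add_neg]
      rfl
    have i1 : Integrable (fun p : ℝ × ℝ => φ' p.1 ^ 2) (μ.prod μ) := by
      refine integrable_of_abs_le_pow (by fun_prop) 0 (C * C) fun p => ?_
      rw [pow_zero, mul_one, pow_two]; exact absmul (hC' _) (hC' _)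
    have i2 : Integrable (fun p : ℝ × ℝ => φ' (Real.cos θ * p.1 - Real.sin θ * p.2) ^ 2)
        (μ.prod μ) := by
      refine integrable_of_abs_le_pow (by fun_prop) 0 (C * C) fun p => ?_
      rw [pow_zero, mul_one, pow_two]; exact absmul (hC' _) (hC' _)
    have i3 : Integrable (fun p : ℝ × ℝ => φ' p.1 * φ' (Real.cos θ * p.1 - Real.sin θ * p.2))
        (μ.prod μ) := by
      refine integrable_of_abs_le_pow (by fun_prop) 0 (C * C) fun p => ?_
      rw [pow_zero, mul_one]; exact absmul (hC' _) (hC' _)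
    have := integral_mono i3 ((i1.add i2).const_mul (1 / 2)) (fun p => by
      simp only [Pi.add_apply]
      nlinarith [sq_nonneg (φ' p.1 - φ' (Real.cos θ * p.1 - Real.sin θ * p.2))])
    rw [integral_const_mul] at this
    simp only [Pi.add_apply] at this
    rw [integral_add i1 i2, e1, e2] at this
    linarith
  set K := ∫ x, φ' x ^ 2 ∂μ with hK
  have hmono : MonotoneOn (fun θ => F θ - Real.cos θ * K) (Set.Icc 0 (Real.pi / 2)) := by
    have hd : ∀ θ, HasDerivAt (fun θ => F θ - Real.cos θ * K)
        (-Real.sin θ * ∫ p, φ' p.1 * φ' (Real.cos θ * p.1 - Real.sin θ * p.2) ∂(μ.prod μ)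
          - (-Real.sin θ) * K) θ := by
      intro θ
      have := hder θ
      rw [hrot θ] at this
      exact this.sub ((Real.hasDerivAt_cos θ).mul_const K)
    refine monotoneOn_of_deriv_nonneg (convex_Icc _ _)
      (fun θ _ => (hd θ).continuousAt.continuousWithinAt)
      (fun θ _ => (hd θ).differentiableAt.differentiableWithinAt) fun θ hθ => ?_
    rw [interior_Icc] at hθ
    rw [(hd θ).deriv]
    have hs : 0 ≤ Real.sin θ :=
      Real.sin_nonneg_of_nonneg_of_le_pi hθ.1.le (by linarith [hθ.2, Real.pi_pos])
    nlinarith [hcs θ]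
  have hfin := hmono (Set.left_mem_Icc.2 (by positivity)) (Set.right_mem_Icc.2 (by positivity))
    (by positivity)
  have hF0 : F 0 = ∫ x, φ x ^ 2 ∂μ := by
    have := integral_fun_fst (μ := μ) (ν := μ) (fun x => φ x ^ 2)
    simpa [hFdef, pow_two] using this
  have hF1 : F (Real.pi / 2) = (∫ x, φ x ∂μ) ^ 2 := by
    simp only [hFdef, Real.cos_pi_div_two, Real.sin_pi_div_two, zero_mul, one_mul, zero_add]
    rw [integral_prod_mul, pow_two]
  simp only [hF0, hF1, Real.cos_zero, Real.cos_pi_div_two, one_mul, zero_mul, sub_zero] at hfin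
  linarith

end Gaussian

/-! ### Continuous functions of polynomial growth on the plane -/

section Tame

/-- The standard Gaussian measure on the plane. -/
abbrev planeGauss : Measure (ℝ × ℝ) := (gaussianReal 0 1).prod (gaussianReal 0 1)

/-- Continuous functions of at most polynomial growth. -/
def Tame (F : ℝ × ℝ → ℝ) : Prop :=
  Continuous F ∧ ∃ (C : ℝ) (k : ℕ), ∀ ξ, |F ξ| ≤ C * (1 + ‖ξ‖) ^ k

namespace Tame

variable {F G : ℝ × ℝ → ℝ}

lemma integrable (hF : Tame F) : Integrable F planeGauss := by
  obtain ⟨hc, C, k, h⟩ := hF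
  exact integrable_of_abs_le_pow hc.measurable k C h

lemma of_bounded (hF : Continuous F) {C : ℝ} (h : ∀ ξ, |F ξ| ≤ C) : Tame F :=
  ⟨hF, C, 0, by simpa using h⟩

lemma const (c : ℝ) : Tame fun _ => c := of_bounded continuous_const fun _ => le_rfl

lemma weight_pow (k : ℕ) : Tame fun ξ => (1 + ‖ξ‖) ^ k :=
  ⟨by fun_prop, 1, k, fun ξ => by rw [one_mul, abs_of_nonneg (by positivity)]⟩

lemma fst : Tame fun ξ => ξ.1 :=
  ⟨continuous_fst, 1, 1, fun ξ => by
    have := norm_fst_le ξ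
    rw [Real.norm_eq_abs] at this; linarith⟩

lemma snd : Tame fun ξ => ξ.2 :=
  ⟨continuous_snd, 1, 1, fun ξ => by
    have := norm_snd_le ξ
    rw [Real.norm_eq_abs] at this; linarith⟩

lemma mul (hF : Tame F) (hG : Tame G) : Tame fun ξ => F ξ * G ξ := by
  obtain ⟨hFc, C, k, hF⟩ := hF
  obtain ⟨hGc, D, l, hG⟩ := hG
  refine ⟨hFc.mul hGc, C * D, k + l, fun ξ => ?_⟩
  rw [abs_mul, pow_add]
  calc |F ξ| * |G ξ| ≤ (C * (1 + ‖ξ‖) ^ k) * (D * (1 + ‖ξ‖) ^ l) :=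
        mul_le_mul (hF ξ) (hG ξ) (abs_nonneg _) ((abs_nonneg _).trans (hF ξ))
    _ = _ := by ring

lemma add (hF : Tame F) (hG : Tame G) : Tame fun ξ => F ξ + G ξ := by
  obtain ⟨hFc, C, k, hF⟩ := hF
  obtain ⟨hGc, D, l, hG⟩ := hG
  refine ⟨hFc.add hGc, |C| + |D|, k + l, fun ξ => ?_⟩
  have h1 : (1 : ℝ) ≤ 1 + ‖ξ‖ := by linarith [norm_nonneg ξ]
  have hk := pow_le_pow_right₀ h1 (Nat.le_add_right k l)
  have hl := pow_le_pow_right₀ h1 (Nat.le_add_left l k)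
  have hC : C * (1 + ‖ξ‖) ^ k ≤ |C| * (1 + ‖ξ‖) ^ (k + l) :=
    mul_le_mul (le_abs_self C) hk (by positivity) (abs_nonneg C)
  have hD : D * (1 + ‖ξ‖) ^ l ≤ |D| * (1 + ‖ξ‖) ^ (k + l) :=
    mul_le_mul (le_abs_self D) hl (by positivity) (abs_nonneg D)
  calc |F ξ + G ξ| ≤ |F ξ| + |G ξ| := abs_add_le _ _
    _ ≤ _ := by rw [add_mul]; linarith [hF ξ, hG ξ]

lemma const_mul (hF : Tame F) (c : ℝ) : Tame fun ξ => c * F ξ := (const c).mul hF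

lemma sub (hF : Tame F) (hG : Tame G) : Tame fun ξ => F ξ - G ξ := by
  simpa [sub_eq_add_neg] using hF.add (hG.const_mul (-1))

lemma pow (hF : Tame F) (k : ℕ) : Tame fun ξ => F ξ ^ k := by
  induction k with
  | zero => simpa using const 1
  | succ k ih => simpa [pow_succ] using ih.mul hF

lemma div (hF : Tame F) (hG : Continuous G) {m : ℝ} (hm : 0 < m) (h : ∀ ξ, m ≤ G ξ) :
    Tame fun ξ => F ξ / G ξ := by
  have hinv : Tame fun ξ => (G ξ)⁻¹ := by
    refine of_bounded (hG.inv₀ fun ξ => (hm.trans_le (h ξ)).ne') (C := m⁻¹) fun ξ => ?_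
    rw [abs_of_pos (inv_pos.2 (hm.trans_le (h ξ)))]
    exact inv_anti₀ hm (h ξ)
  simpa [div_eq_mul_inv] using hF.mul hinv

end Tame

/-- Quadratic forms under the standard Gaussian measure of the plane. -/
lemma planeGauss_integral_sq (c₁ c₂ : ℝ) :
    ∫ ξ : ℝ × ℝ, (c₁ * ξ.1 + c₂ * ξ.2) ^ 2 ∂planeGauss = c₁ ^ 2 + c₂ ^ 2 := by
  have hsq : ∫ x, x ^ 2 ∂(gaussianReal 0 1) = 1 := by
    have := variance_fun_id_gaussianReal (μ := 0) (v := 1)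
    rw [variance_of_integral_eq_zero (by fun_prop) (by simp)] at this
    simpa using this
  have h1 : ∫ ξ : ℝ × ℝ, ξ.1 ^ 2 ∂planeGauss = 1 := by
    rw [← hsq]
    simpa using integral_fun_fst (μ := gaussianReal 0 1) (ν := gaussianReal 0 1)
      (fun x : ℝ => x ^ 2)
  have h2 : ∫ ξ : ℝ × ℝ, ξ.2 ^ 2 ∂planeGauss = 1 := by
    rw [← hsq]
    simpa using integral_fun_snd (μ := gaussianReal 0 1) (ν := gaussianReal 0 1)
      (fun x : ℝ => x ^ 2)
  have h3 : ∫ ξ : ℝ × ℝ, ξ.1 * ξ.2 ∂planeGauss = 0 := by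
    have := integral_prod_mul (μ := gaussianReal 0 1) (ν := gaussianReal 0 1)
      (fun x : ℝ => x) (fun x : ℝ => x)
    simpa using this
  have e : ∀ ξ : ℝ × ℝ, (c₁ * ξ.1 + c₂ * ξ.2) ^ 2
      = c₁ ^ 2 * ξ.1 ^ 2 + (2 * c₁ * c₂) * (ξ.1 * ξ.2) + c₂ ^ 2 * ξ.2 ^ 2 := fun ξ => by ring
  have t1 := (Tame.fst.pow 2).const_mul (c₁ ^ 2)
  have t2 := (Tame.fst.mul Tame.snd).const_mul (2 * c₁ * c₂)
  have t3 := (Tame.snd.pow 2).const_mul (c₂ ^ 2)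
  simp_rw [e]
  rw [integral_add (t1.add t2).integrable t3.integrable, integral_add t1.integrable t2.integrable,
    integral_const_mul, integral_const_mul, integral_const_mul, h1, h2, h3]
  ring

/-- Gaussian integration by parts in the first variable. -/
lemma planeGauss_integral_fst_mul {F F' : ℝ × ℝ → ℝ} {C : ℝ} (hF : Continuous F)
    (hF' : Continuous F') (hd : ∀ a b, HasDerivAt (fun t => F (t, b)) (F' (a, b)) a)
    (hC : ∀ ξ, |F ξ| ≤ C) (hC' : ∀ a b, |F' (a, b)| ≤ C * (1 + |b|)) :
    ∫ ξ, ξ.1 * F ξ ∂planeGauss = ∫ ξ, F' ξ ∂planeGauss := by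
  have hC0 : 0 ≤ C := (abs_nonneg _).trans (hC 0)
  have t1 : Tame F := .of_bounded hF hC
  have t2 : Tame F' := ⟨hF', C, 1, fun ξ => (hC' ξ.1 ξ.2).trans (by
    have := norm_snd_le ξ
    rw [Real.norm_eq_abs] at this
    rw [pow_one]; gcongr)⟩
  rw [integral_prod_symm _ (Tame.fst.mul t1).integrable, integral_prod_symm _ t2.integrable]
  congr 1; ext b
  refine integral_id_mul_gaussianReal (C := C * (1 + |b|)) (fun a => hd a b) (by fun_prop)
    (fun a => (hC _).trans ?_) (fun a => hC' a b)
  nlinarith [abs_nonneg b]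

/-- Gaussian integration by parts in the second variable. -/
lemma planeGauss_integral_snd_mul {F F' : ℝ × ℝ → ℝ} {C : ℝ} (hF : Continuous F)
    (hF' : Continuous F') (hd : ∀ a b, HasDerivAt (fun t => F (a, t)) (F' (a, b)) b)
    (hC : ∀ ξ, |F ξ| ≤ C) (hC' : ∀ a b, |F' (a, b)| ≤ C * (1 + |a|)) :
    ∫ ξ, ξ.2 * F ξ ∂planeGauss = ∫ ξ, F' ξ ∂planeGauss := by
  have hC0 : 0 ≤ C := (abs_nonneg _).trans (hC 0)
  have t1 : Tame F := .of_bounded hF hC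
  have t2 : Tame F' := ⟨hF', C, 1, fun ξ => (hC' ξ.1 ξ.2).trans (by
    have := norm_fst_le ξ
    rw [Real.norm_eq_abs] at this
    rw [pow_one]; gcongr)⟩
  rw [integral_prod _ (Tame.snd.mul t1).integrable, integral_prod _ t2.integrable]
  congr 1; ext a
  refine integral_id_mul_gaussianReal (C := C * (1 + |a|)) (fun b => hd a b) (by fun_prop)
    (fun b => (hC _).trans ?_) (fun b => hC' a b)
  nlinarith [abs_nonneg a]

/-- Expansion of a mean square deviation. -/
lemma integral_sub_const_sq {α : Type*} [MeasurableSpace α] (μ : Measure α)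
    [IsProbabilityMeasure μ] {f : α → ℝ} (hf : Integrable f μ)
    (hf2 : Integrable (fun x => f x ^ 2) μ) (c : ℝ) :
    ∫ x, (f x - c) ^ 2 ∂μ = ∫ x, f x ^ 2 ∂μ - 2 * c * ∫ x, f x ∂μ + c ^ 2 := by
  have h1 : Integrable (fun x => f x ^ 2 - 2 * c * f x) μ := hf2.sub (hf.const_mul _)
  have : ∀ x, (f x - c) ^ 2 = (f x ^ 2 - 2 * c * f x) + c ^ 2 := fun x => by ring
  simp_rw [this]
  rw [integral_add h1 (integrable_const _), integral_sub hf2 (hf.const_mul _),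
    integral_const_mul]
  simp

/-- Jensen's inequality for the square. -/
lemma sq_integral_le {α : Type*} [MeasurableSpace α] (μ : Measure α) [IsProbabilityMeasure μ]
    {f : α → ℝ} (hf : Integrable f μ) (hf2 : Integrable (fun x => f x ^ 2) μ) :
    (∫ x, f x ∂μ) ^ 2 ≤ ∫ x, f x ^ 2 ∂μ := by
  have h := integral_sub_const_sq μ hf hf2 (∫ x, f x ∂μ)
  have h0 : 0 ≤ ∫ x, (f x - ∫ x, f x ∂μ) ^ 2 ∂μ := integral_nonneg fun x => sq_nonneg _
  nlinarith

/-- The Gaussian Poincaré inequality in the plane. -/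
lemma planeGauss_poincare {F F₁ F₂ : ℝ × ℝ → ℝ} {C : ℝ} (hF : Continuous F)
    (hF₁ : Continuous F₁) (hF₂ : Continuous F₂)
    (hd₁ : ∀ a b, HasDerivAt (fun t => F (t, b)) (F₁ (a, b)) a)
    (hd₂ : ∀ a b, HasDerivAt (fun t => F (a, t)) (F₂ (a, b)) b)
    (hC : ∀ ξ, |F ξ| ≤ C) (hC₁ : ∀ a b, |F₁ (a, b)| ≤ C * (1 + |b|))
    (hC₂ : ∀ a b, |F₂ (a, b)| ≤ C * (1 + |a|)) :
    ∫ ξ, F ξ ^ 2 ∂planeGauss - (∫ ξ, F ξ ∂planeGauss) ^ 2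
      ≤ ∫ ξ, (F₁ ξ ^ 2 + F₂ ξ ^ 2) ∂planeGauss := by
  have hC0 : 0 ≤ C := (abs_nonneg _).trans (hC 0)
  have t : Tame F := .of_bounded hF hC
  have t1 : Tame F₁ := ⟨hF₁, C, 1, fun ξ => (hC₁ ξ.1 ξ.2).trans (by
    have := norm_snd_le ξ
    rw [Real.norm_eq_abs] at this
    rw [pow_one]; gcongr)⟩
  have t2 : Tame F₂ := ⟨hF₂, C, 1, fun ξ => (hC₂ ξ.1 ξ.2).trans (by
    have := norm_fst_le ξ
    rw [Real.norm_eq_abs] at this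
    rw [pow_one]; gcongr)⟩
  set μ : Measure ℝ := gaussianReal 0 1
  set A : ℝ → ℝ := fun b => ∫ a, F (a, b) ∂μ with hA
  have hFa : ∀ b, Integrable (fun a => F (a, b)) μ := fun b =>
    integrable_of_abs_le_pow (by fun_prop) 0 C fun a => by simpa using hC (a, b)
  have hFb : ∀ a, Integrable (fun b => F (a, b)) μ := fun a =>
    integrable_of_abs_le_pow (by fun_prop) 0 C fun b => by simpa using hC (a, b)
  have hAC : ∀ b, |A b| ≤ C := fun b => by
    have := norm_integral_le_of_norm_le_const (μ := μ) (f := fun a => F (a, b)) (C := C)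
      (Filter.Eventually.of_forall fun a => hC (a, b))
    simpa using this
  have hAcont : Continuous A :=
    continuous_of_dominated (bound := fun _ => C)
      (fun b => (hFa b).aestronglyMeasurable)
      (fun b => Filter.Eventually.of_forall fun a => hC (a, b)) (integrable_const _)
      (Filter.Eventually.of_forall fun a => by fun_prop)
  have hAi : Integrable A μ :=
    integrable_of_abs_le_pow (by fun_prop) 0 C (by simpa using hAC)
  have hA2 : Integrable (fun b => A b ^ 2) μ :=
    integrable_of_abs_le_pow (by fun_prop) 0 (C ^ 2) fun b => by
      rw [pow_zero, mul_one, abs_pow]; exact pow_le_pow_left₀ (abs_nonneg _) (hAC b) 2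
  have hEF : ∫ ξ, F ξ ∂planeGauss = ∫ b, A b ∂μ := integral_prod_symm _ t.integrable
  -- the fluctuation in the first variable
  have s1 : ∫ ξ, F ξ ^ 2 ∂planeGauss - ∫ b, A b ^ 2 ∂μ ≤ ∫ ξ, F₁ ξ ^ 2 ∂planeGauss := by
    have i1 := (t.pow 2).integrable.integral_prod_right
    rw [integral_prod_symm _ (t.pow 2).integrable, integral_prod_symm _ (t1.pow 2).integrable,
      ← integral_sub i1 hA2]
    refine integral_mono (i1.sub hA2) (t1.pow 2).integrable.integral_prod_right fun b => ?_
    exact gaussianReal_poincare (C := C * (1 + |b|)) (fun a => hd₁ a b) (by fun_prop)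
      (fun a => (hC _).trans (by nlinarith [abs_nonneg b])) (fun a => hC₁ a b)
  -- the fluctuation of the average in the second variable
  have s2 : ∫ b, A b ^ 2 ∂μ - (∫ b, A b ∂μ) ^ 2 ≤ ∫ ξ, F₂ ξ ^ 2 ∂planeGauss := by
    set c := ∫ b, A b ∂μ with hc
    set B : ℝ → ℝ := fun a => ∫ b, F (a, b) ∂μ with hB
    have hBC : ∀ a, |B a| ≤ C := fun a => by
      have := norm_integral_le_of_norm_le_const (μ := μ) (f := fun b => F (a, b)) (C := C)
        (Filter.Eventually.of_forall fun b => hC (a, b))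
      simpa using this
    have hBcont : Continuous B :=
      continuous_of_dominated (bound := fun _ => C)
        (fun a => (hFb a).aestronglyMeasurable)
        (fun a => Filter.Eventually.of_forall fun b => hC (a, b)) (integrable_const _)
        (Filter.Eventually.of_forall fun b => by fun_prop)
    have hBi : Integrable B μ :=
      integrable_of_abs_le_pow (by fun_prop) 0 C (by simpa using hBC)
    have tB : Tame fun ξ => B ξ.1 := .of_bounded (by fun_prop) fun ξ => hBC ξ.1
    have hBc : ∫ a, B a ∂μ = c := by
      rw [← hEF]; exact (integral_prod _ t.integrable).symm
    have e1 : ∫ b, A b ^ 2 ∂μ - c ^ 2 = ∫ b, (A b - c) ^ 2 ∂μ := by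
      rw [integral_sub_const_sq μ hAi hA2, ← hc]
      ring
    have e2 : ∫ b, (A b - c) ^ 2 ∂μ ≤ ∫ ξ, (F ξ - B ξ.1) ^ 2 ∂planeGauss := by
      rw [integral_prod_symm _ ((t.sub tB).pow 2).integrable]
      have i1 : Integrable (fun b => (A b - c) ^ 2) μ :=
        integrable_of_abs_le_pow (by fun_prop) 0 ((C + |c|) ^ 2) fun b => by
          rw [pow_zero, mul_one, abs_pow]
          exact pow_le_pow_left₀ (abs_nonneg _)
            ((abs_sub _ _).trans (add_le_add_left (hAC b) _)) 2
      refine integral_mono i1 ((t.sub tB).pow 2).integrable.integral_prod_right fun b => ?_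
      have hi : Integrable (fun a => F (a, b) - B a) μ := (hFa b).sub hBi
      have hi2 : Integrable (fun a => (F (a, b) - B a) ^ 2) μ :=
        integrable_of_abs_le_pow (by fun_prop) 0 ((C + C) ^ 2) fun a => by
          rw [pow_zero, mul_one, abs_pow]
          exact pow_le_pow_left₀ (abs_nonneg _)
            ((abs_sub _ _).trans (add_le_add (hC _) (hBC a))) 2
      have := sq_integral_le μ hi hi2
      rw [integral_sub (hFa b) hBi, hBc] at this
      exact this
    have e3 : ∫ ξ, (F ξ - B ξ.1) ^ 2 ∂planeGauss ≤ ∫ ξ, F₂ ξ ^ 2 ∂planeGauss := by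
      rw [integral_prod _ ((t.sub tB).pow 2).integrable, integral_prod _ (t2.pow 2).integrable]
      refine integral_mono ((t.sub tB).pow 2).integrable.integral_prod_left
        (t2.pow 2).integrable.integral_prod_left fun a => ?_
      have hp := gaussianReal_poincare (φ := fun b => F (a, b)) (φ' := fun b => F₂ (a, b))
        (C := C * (1 + |a|)) (fun b => hd₂ a b) (by fun_prop)
        (fun b => (hC _).trans (by nlinarith [abs_nonneg a])) (fun b => hC₂ a b)
      refine le_trans (le_of_eq ?_) hp
      have hi2 : Integrable (fun b => F (a, b) ^ 2) μ :=
        integrable_of_abs_le_pow (by fun_prop) 0 (C ^ 2) fun b => by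
          rw [pow_zero, mul_one, abs_pow]; exact pow_le_pow_left₀ (abs_nonneg _) (hC _) 2
      refine (integral_sub_const_sq μ (hFb a) hi2 (B a)).trans ?_
      change _ - 2 * B a * B a + B a ^ 2 = _ - (B a) ^ 2
      ring
    linarith
  rw [integral_add (t1.pow 2).integrable (t2.pow 2).integrable, hEF]
  linarith

end Tame

/-! ### One step of the walk, seen from the plane of increments -/

section PlaneStep

/-- Moments of the weight `1 + ‖ξ‖` under the Gaussian measure of the plane. -/
def weightMoment (k : ℕ) : ℝ := ∫ ξ : ℝ × ℝ, (1 + ‖ξ‖) ^ k ∂planeGauss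

lemma weightMoment_nonneg (k : ℕ) : 0 ≤ weightMoment k :=
  integral_nonneg fun ξ => by positivity

lemma abs_fst_le_weight (ξ : ℝ × ℝ) : |ξ.1| ≤ 1 + ‖ξ‖ := by
  have := norm_fst_le ξ
  rw [Real.norm_eq_abs] at this; linarith

lemma abs_snd_le_weight (ξ : ℝ × ℝ) : |ξ.2| ≤ 1 + ‖ξ‖ := by
  have := norm_snd_le ξ
  rw [Real.norm_eq_abs] at this; linarith

/-- Monotonicity of the Gaussian integral on functions of polynomial growth. -/
lemma Tame.integral_mono {F G : ℝ × ℝ → ℝ} (hF : Tame F) (hG : Tame G) (h : ∀ ξ, F ξ ≤ G ξ) :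
    ∫ ξ, F ξ ∂planeGauss ≤ ∫ ξ, G ξ ∂planeGauss :=
  MeasureTheory.integral_mono hF.integrable hG.integrable h

lemma Tame.integral_add {F G : ℝ × ℝ → ℝ} (hF : Tame F) (hG : Tame G) :
    ∫ ξ, (F ξ + G ξ) ∂planeGauss = ∫ ξ, F ξ ∂planeGauss + ∫ ξ, G ξ ∂planeGauss :=
  MeasureTheory.integral_add hF.integrable hG.integrable

lemma Tame.integral_sub {F G : ℝ × ℝ → ℝ} (hF : Tame F) (hG : Tame G) :
    ∫ ξ, (F ξ - G ξ) ∂planeGauss = ∫ ξ, F ξ ∂planeGauss - ∫ ξ, G ξ ∂planeGauss :=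
  MeasureTheory.integral_sub hF.integrable hG.integrable

/-- A positive function of the increment, together with horizontal derivatives `X`, `Y` and
vertical derivative `Z`, for a step of size `ε` of the Heisenberg walk. -/
structure StepData (ε m M L : ℝ) (G X Y Z : ℝ × ℝ → ℝ) : Prop where
  eps_nonneg : 0 ≤ ε
  eps_le_one : ε ≤ 1
  pos : 0 < m
  cont : Continuous G
  contX : Continuous X
  contY : Continuous Y
  contZ : Continuous Z
  lower : ∀ ξ, m ≤ G ξ
  upper : ∀ ξ, G ξ ≤ M
  boundX : ∀ ξ, |X ξ| ≤ L
  boundY : ∀ ξ, |Y ξ| ≤ L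
  boundZ : ∀ ξ, |Z ξ| ≤ L
  deriv_fst : ∀ a b, HasDerivAt (fun t => G (t, b)) (ε * (X (a, b) + ε / 2 * b * Z (a, b))) a
  deriv_snd : ∀ a b, HasDerivAt (fun t => G (a, t)) (ε * (Y (a, b) - ε / 2 * a * Z (a, b))) b

namespace StepData

variable {ε m M L : ℝ} {G X Y Z : ℝ × ℝ → ℝ}

lemma L_nonneg (d : StepData ε m M L G X Y Z) : 0 ≤ L := (abs_nonneg _).trans (d.boundX 0)

lemma M_pos (d : StepData ε m M L G X Y Z) : 0 < M :=
  d.pos.trans_le ((d.lower 0).trans (d.upper 0))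

lemma G_pos (d : StepData ε m M L G X Y Z) (ξ : ℝ × ℝ) : 0 < G ξ := d.pos.trans_le (d.lower ξ)

lemma abs_G_le (d : StepData ε m M L G X Y Z) (ξ : ℝ × ℝ) : |G ξ| ≤ M := by
  rw [abs_of_pos (d.G_pos ξ)]; exact d.upper ξ

lemma tame (d : StepData ε m M L G X Y Z) : Tame G := .of_bounded d.cont d.abs_G_le
lemma tameX (d : StepData ε m M L G X Y Z) : Tame X := .of_bounded d.contX d.boundX
lemma tameY (d : StepData ε m M L G X Y Z) : Tame Y := .of_bounded d.contY d.boundY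
lemma tameZ (d : StepData ε m M L G X Y Z) : Tame Z := .of_bounded d.contZ d.boundZ

lemma tame_div (d : StepData ε m M L G X Y Z) {F : ℝ × ℝ → ℝ} (hF : Tame F) :
    Tame fun ξ => F ξ / G ξ := hF.div d.cont d.pos d.lower

lemma mean_ge (d : StepData ε m M L G X Y Z) : m ≤ ∫ ξ, G ξ ∂planeGauss := by
  simpa using (Tame.const m).integral_mono d.tame d.lower

lemma mean_le (d : StepData ε m M L G X Y Z) : ∫ ξ, G ξ ∂planeGauss ≤ M := by
  simpa using d.tame.integral_mono (Tame.const M) d.upper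

lemma mean_pos (d : StepData ε m M L G X Y Z) : 0 < ∫ ξ, G ξ ∂planeGauss :=
  d.pos.trans_le d.mean_ge

lemma abs_partial_fst_le (d : StepData ε m M L G X Y Z) (a b : ℝ) :
    |ε * (X (a, b) + ε / 2 * b * Z (a, b))| ≤ (M + L) * (1 + |b|) := by
  have h0 := d.eps_nonneg
  have h1 := d.eps_le_one
  have hL := d.L_nonneg
  have hM := d.M_pos
  have hb := abs_nonneg b
  have hX := d.boundX (a, b)
  have hZ := d.boundZ (a, b)
  rw [abs_mul, abs_of_nonneg h0]
  have e2 : |X (a, b) + ε / 2 * b * Z (a, b)| ≤ L + |b| * L := by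
    refine (abs_add_le _ _).trans (add_le_add hX ?_)
    rw [abs_mul, abs_mul, abs_of_nonneg (by positivity : 0 ≤ ε / 2)]
    exact mul_le_mul (by nlinarith) hZ (abs_nonneg _) hb
  calc ε * |X (a, b) + ε / 2 * b * Z (a, b)| ≤ 1 * (L + |b| * L) :=
        mul_le_mul h1 e2 (abs_nonneg _) zero_le_one
    _ ≤ _ := by nlinarith

lemma abs_partial_snd_le (d : StepData ε m M L G X Y Z) (a b : ℝ) :
    |ε * (Y (a, b) - ε / 2 * a * Z (a, b))| ≤ (M + L) * (1 + |a|) := by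
  have h0 := d.eps_nonneg
  have h1 := d.eps_le_one
  have hL := d.L_nonneg
  have hM := d.M_pos
  have hb := abs_nonneg a
  have hX := d.boundY (a, b)
  have hZ := d.boundZ (a, b)
  rw [abs_mul, abs_of_nonneg h0]
  have e2 : |Y (a, b) - ε / 2 * a * Z (a, b)| ≤ L + |a| * L := by
    refine (abs_sub _ _).trans (add_le_add hX ?_)
    rw [abs_mul, abs_mul, abs_of_nonneg (by positivity : 0 ≤ ε / 2)]
    exact mul_le_mul (by nlinarith) hZ (abs_nonneg _) hb
  calc ε * |Y (a, b) - ε / 2 * a * Z (a, b)| ≤ 1 * (L + |a| * L) :=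
        mul_le_mul h1 e2 (abs_nonneg _) zero_le_one
    _ ≤ _ := by nlinarith

lemma integral_fst_mul (d : StepData ε m M L G X Y Z) :
    ∫ ξ, ξ.1 * G ξ ∂planeGauss
      = ε * (∫ ξ, X ξ ∂planeGauss + ε / 2 * ∫ ξ, ξ.2 * Z ξ ∂planeGauss) := by
  have := d.contX
  have := d.contZ
  rw [planeGauss_integral_fst_mul (F' := fun ξ => ε * (X ξ + ε / 2 * ξ.2 * Z ξ)) (C := M + L)
    d.cont (by fun_prop) d.deriv_fst (fun ξ => (d.abs_G_le ξ).trans (by linarith [d.L_nonneg]))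
    d.abs_partial_fst_le, integral_const_mul]
  simp_rw [mul_assoc (ε / 2)]
  rw [d.tameX.integral_add ((Tame.snd.mul d.tameZ).const_mul _), integral_const_mul]

lemma integral_snd_mul (d : StepData ε m M L G X Y Z) :
    ∫ ξ, ξ.2 * G ξ ∂planeGauss
      = ε * (∫ ξ, Y ξ ∂planeGauss - ε / 2 * ∫ ξ, ξ.1 * Z ξ ∂planeGauss) := by
  have := d.contY
  have := d.contZ
  rw [planeGauss_integral_snd_mul (F' := fun ξ => ε * (Y ξ - ε / 2 * ξ.1 * Z ξ)) (C := M + L)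
    d.cont (by fun_prop) d.deriv_snd (fun ξ => (d.abs_G_le ξ).trans (by linarith [d.L_nonneg]))
    d.abs_partial_snd_le, integral_const_mul]
  simp_rw [mul_assoc (ε / 2)]
  rw [d.tameY.integral_sub ((Tame.fst.mul d.tameZ).const_mul _), integral_const_mul]

/-- Weighted Cauchy–Schwarz inequality. -/
lemma sq_integral_le_mul (d : StepData ε m M L G X Y Z) {F : ℝ × ℝ → ℝ} (hF : Tame F) :
    (∫ ξ, F ξ ∂planeGauss) ^ 2 ≤ (∫ ξ, G ξ ∂planeGauss) * ∫ ξ, F ξ ^ 2 / G ξ ∂planeGauss := by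
  set p := ∫ ξ, G ξ ∂planeGauss with hp
  set u := ∫ ξ, F ξ ∂planeGauss with hu
  have hp0 : 0 < p := d.mean_pos
  have t1 := hF.const_mul (2 * u)
  have t2 := d.tame.const_mul (u ^ 2 / p)
  have t3 := (d.tame_div (hF.pow 2)).const_mul p
  have key := t1.integral_mono (t2.add t3) fun ξ => by
    have hG := d.G_pos ξ
    have : u ^ 2 / p * G ξ + p * (F ξ ^ 2 / G ξ) - 2 * u * F ξ
        = (u * G ξ - p * F ξ) ^ 2 / (p * G ξ) := by field_simp; ring
    have h2 : 0 ≤ (u * G ξ - p * F ξ) ^ 2 / (p * G ξ) := by positivity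
    linarith
  rw [t2.integral_add t3, integral_const_mul, integral_const_mul, integral_const_mul, ← hp,
    ← hu, div_mul_cancel₀ _ hp0.ne'] at key
  nlinarith

/-- The vertical gain is nonnegative and controls the Gaussian moments of the recentred vertical
derivative. -/
lemma sq_moment_le (d : StepData ε m M L G X Y Z) {R : ℝ} (hR : 0 < R)
    (hq : ∀ c₁ c₂ : ℝ, ∫ ξ : ℝ × ℝ, (c₁ * ξ.1 + c₂ * ξ.2) ^ 2 * G ξ ∂planeGauss
      ≤ R * (c₁ ^ 2 + c₂ ^ 2) * ∫ ξ, G ξ ∂planeGauss) {c : ℝ}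
    (hc : c = (∫ ξ, Z ξ ∂planeGauss) / ∫ ξ, G ξ ∂planeGauss) :
    (∫ ξ, ξ.2 * (Z ξ - c * G ξ) ∂planeGauss) ^ 2 + (∫ ξ, ξ.1 * (Z ξ - c * G ξ) ∂planeGauss) ^ 2
      ≤ R * (∫ ξ, G ξ ∂planeGauss) * (∫ ξ, Z ξ ^ 2 / G ξ ∂planeGauss
        - (∫ ξ, Z ξ ∂planeGauss) ^ 2 / ∫ ξ, G ξ ∂planeGauss) := by
  set p := ∫ ξ, G ξ ∂planeGauss with hp
  set z := ∫ ξ, Z ξ ∂planeGauss with hz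
  have hp0 : 0 < p := d.mean_pos
  have tq : Tame fun ξ => Z ξ - c * G ξ := d.tameZ.sub (d.tame.const_mul c)
  set w₁ := ∫ ξ, ξ.2 * (Z ξ - c * G ξ) ∂planeGauss with hw₁
  set w₂ := ∫ ξ, ξ.1 * (Z ξ - c * G ξ) ∂planeGauss with hw₂
  have eD : ∫ ξ, (Z ξ - c * G ξ) ^ 2 / G ξ ∂planeGauss
      = ∫ ξ, Z ξ ^ 2 / G ξ ∂planeGauss - z ^ 2 / p := by
    have e : ∀ ξ, (Z ξ - c * G ξ) ^ 2 / G ξ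
        = Z ξ ^ 2 / G ξ - (2 * c * Z ξ - c ^ 2 * G ξ) := fun ξ => by
      have := (d.G_pos ξ).ne'
      field_simp; ring
    simp_rw [e]
    rw [(d.tame_div (d.tameZ.pow 2)).integral_sub
      ((d.tameZ.const_mul _).sub (d.tame.const_mul _)),
      (d.tameZ.const_mul (2 * c)).integral_sub (d.tame.const_mul _), integral_const_mul,
      integral_const_mul, ← hp, ← hz, hc]
    field_simp; ring
  rw [← eD]
  have tl : Tame fun ξ : ℝ × ℝ => w₂ * ξ.1 + w₁ * ξ.2 :=
    (Tame.fst.const_mul _).add (Tame.snd.const_mul _)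
  have t2 := ((tl.pow 2).mul d.tame).const_mul (1 / (R * p))
  have t3 := (d.tame_div (tq.pow 2)).const_mul (R * p)
  have ta := (Tame.fst.mul tq).const_mul (2 * w₂)
  have tb := (Tame.snd.mul tq).const_mul (2 * w₁)
  have key := (ta.add tb).integral_mono (t2.add t3) fun ξ => by
    have hG := d.G_pos ξ
    have : 1 / (R * p) * ((w₂ * ξ.1 + w₁ * ξ.2) ^ 2 * G ξ)
        + R * p * ((Z ξ - c * G ξ) ^ 2 / G ξ)
        - (2 * w₂ * (ξ.1 * (Z ξ - c * G ξ)) + 2 * w₁ * (ξ.2 * (Z ξ - c * G ξ)))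
        = ((w₂ * ξ.1 + w₁ * ξ.2) * G ξ - R * p * (Z ξ - c * G ξ)) ^ 2 / (R * p * G ξ) := by
      field_simp; ring
    have h2 : 0 ≤ ((w₂ * ξ.1 + w₁ * ξ.2) * G ξ - R * p * (Z ξ - c * G ξ)) ^ 2
      / (R * p * G ξ) := by positivity
    linarith
  rw [ta.integral_add tb, t2.integral_add t3, integral_const_mul, integral_const_mul,
    integral_const_mul, integral_const_mul, ← hw₁, ← hw₂] at key
  have h4 : 1 / (R * p) * ∫ ξ : ℝ × ℝ, (w₂ * ξ.1 + w₁ * ξ.2) ^ 2 * G ξ ∂planeGauss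
      ≤ w₂ ^ 2 + w₁ ^ 2 := by
    rw [one_div, inv_mul_le_iff₀ (by positivity)]
    exact (hq w₂ w₁).trans (le_of_eq (by ring))
  nlinarith

/-- Propagation of the horizontal gradient through one step of the walk. -/
lemma gradient_step (d : StepData ε m M L G X Y Z) {R s : ℝ} (hR : 0 < R) (hs : 0 < s)
    (hq : ∀ c₁ c₂ : ℝ, ∫ ξ : ℝ × ℝ, (c₁ * ξ.1 + c₂ * ξ.2) ^ 2 * G ξ ∂planeGauss
      ≤ R * (c₁ ^ 2 + c₂ ^ 2) * ∫ ξ, G ξ ∂planeGauss) :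
    ((∫ ξ, (X ξ + ε * ξ.2 * Z ξ) ∂planeGauss) ^ 2
        + (∫ ξ, (Y ξ - ε * ξ.1 * Z ξ) ∂planeGauss) ^ 2) / ∫ ξ, G ξ ∂planeGauss
      ≤ (1 + s * ε ^ 2) * ∫ ξ, (X ξ ^ 2 + Y ξ ^ 2) / G ξ ∂planeGauss
        + (ε ^ 2 + 1 / s) * R * (∫ ξ, Z ξ ^ 2 / G ξ ∂planeGauss
          - (∫ ξ, Z ξ ∂planeGauss) ^ 2 / ∫ ξ, G ξ ∂planeGauss) := by
  have hW := d.sq_moment_le hR hq rfl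
  have hU₁ := d.sq_integral_le_mul d.tameX
  have hU₂ := d.sq_integral_le_mul d.tameY
  have hA := d.integral_fst_mul
  have hB := d.integral_snd_mul
  set p := ∫ ξ, G ξ ∂planeGauss with hp
  set c := (∫ ξ, Z ξ ∂planeGauss) / p with hc
  have hp0 : 0 < p := d.mean_pos
  have t1 := (Tame.snd.mul d.tameZ).const_mul ε
  have t2 := (Tame.fst.mul d.tameZ).const_mul ε
  simp_rw [mul_assoc ε]
  rw [d.tameX.integral_add t1, d.tameY.integral_sub t2, integral_const_mul, integral_const_mul]
  have eW₁ : ∫ ξ, ξ.2 * (Z ξ - c * G ξ) ∂planeGauss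
      = ∫ ξ, ξ.2 * Z ξ ∂planeGauss - c * ∫ ξ, ξ.2 * G ξ ∂planeGauss := by
    rw [← integral_const_mul, ← (Tame.snd.mul d.tameZ).integral_sub
      ((Tame.snd.mul d.tame).const_mul c)]
    congr 1; ext ξ; ring
  have eW₂ : ∫ ξ, ξ.1 * (Z ξ - c * G ξ) ∂planeGauss
      = ∫ ξ, ξ.1 * Z ξ ∂planeGauss - c * ∫ ξ, ξ.1 * G ξ ∂planeGauss := by
    rw [← integral_const_mul, ← (Tame.fst.mul d.tameZ).integral_sub
      ((Tame.fst.mul d.tame).const_mul c)]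
    congr 1; ext ξ; ring
  rw [eW₁, eW₂, hA, hB] at hW
  have hN : ∫ ξ, (X ξ ^ 2 + Y ξ ^ 2) / G ξ ∂planeGauss
      = ∫ ξ, X ξ ^ 2 / G ξ ∂planeGauss + ∫ ξ, Y ξ ^ 2 / G ξ ∂planeGauss := by
    simp_rw [add_div]
    exact (d.tame_div (d.tameX.pow 2)).integral_add (d.tame_div (d.tameY.pow 2))
  rw [hN]
  set D := ∫ ξ, Z ξ ^ 2 / G ξ ∂planeGauss - (∫ ξ, Z ξ ∂planeGauss) ^ 2 / p
  set U₁ := ∫ ξ, X ξ ∂planeGauss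
  set U₂ := ∫ ξ, Y ξ ∂planeGauss
  set α := ∫ ξ, ξ.1 * Z ξ ∂planeGauss
  set β := ∫ ξ, ξ.2 * Z ξ ∂planeGauss
  set N₁ := ∫ ξ, X ξ ^ 2 / G ξ ∂planeGauss
  set N₂ := ∫ ξ, Y ξ ^ 2 / G ξ ∂planeGauss
  clear_value p c D U₁ U₂ α β N₁ N₂
  set W₁ := β - c * (ε * (U₂ - ε / 2 * α)) with hW₁
  set W₂ := α - c * (ε * (U₁ + ε / 2 * β)) with hW₂
  set τ := c * ε ^ 2 / 2 with hτ
  have young : ∀ u w : ℝ, (u + ε * w) ^ 2 ≤ (1 + s * ε ^ 2) * u ^ 2 + (ε ^ 2 + 1 / s) * w ^ 2 := by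
    intro u w
    have : (1 + s * ε ^ 2) * u ^ 2 + (ε ^ 2 + 1 / s) * w ^ 2 - (u + ε * w) ^ 2
        = (s * ε * u - w) ^ 2 / s := by field_simp; ring
    have : 0 ≤ (s * ε * u - w) ^ 2 / s := by positivity
    linarith
  have y₁ := young (U₁ + τ * U₂) W₁
  have y₂ := young (U₂ - τ * U₁) (-W₂)
  have i₁ : U₁ + τ * U₂ + ε * W₁ = (U₁ + ε * β) - τ * (U₂ - ε * α) := by
    rw [hW₁, hτ]; ring
  have i₂ : U₂ - τ * U₁ + ε * -W₂ = (U₂ - ε * α) + τ * (U₁ + ε * β) := by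
    rw [hW₂, hτ]; ring
  rw [i₁] at y₁
  rw [i₂] at y₂
  clear_value W₁ W₂ τ
  set V₁ := U₁ + ε * β
  set V₂ := U₂ - ε * α
  clear_value V₁ V₂
  have hk : 0 < ε ^ 2 + 1 / s := by positivity
  have hτ1 : 1 ≤ 1 + τ ^ 2 := by nlinarith [sq_nonneg τ]
  have main : V₁ ^ 2 + V₂ ^ 2
      ≤ (1 + s * ε ^ 2) * (U₁ ^ 2 + U₂ ^ 2) + (ε ^ 2 + 1 / s) * (W₁ ^ 2 + W₂ ^ 2) := by
    have h1 : (1 + τ ^ 2) * (V₁ ^ 2 + V₂ ^ 2)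
        ≤ (1 + τ ^ 2) * ((1 + s * ε ^ 2) * (U₁ ^ 2 + U₂ ^ 2))
          + (ε ^ 2 + 1 / s) * (W₁ ^ 2 + W₂ ^ 2) := by linarith
    have h2 : (ε ^ 2 + 1 / s) * (W₁ ^ 2 + W₂ ^ 2)
        ≤ (1 + τ ^ 2) * ((ε ^ 2 + 1 / s) * (W₁ ^ 2 + W₂ ^ 2)) :=
      le_mul_of_one_le_left (by positivity) hτ1
    refine le_of_mul_le_mul_left (h1.trans ?_) (by linarith : 0 < 1 + τ ^ 2)
    linarith
  rw [div_le_iff₀ hp0]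
  have hs2 : 0 ≤ 1 + s * ε ^ 2 := by positivity
  have h3 := mul_le_mul_of_nonneg_left (add_le_add hU₁ hU₂) hs2
  have h4 := mul_le_mul_of_nonneg_left hW hk.le
  calc _ ≤ _ := main
    _ ≤ (1 + s * ε ^ 2) * (p * N₁ + p * N₂) + (ε ^ 2 + 1 / s) * (R * p * D) := add_le_add h3 h4
    _ = _ := by ring

/-- Coarse comparison of weighted quadratic forms. -/
lemma quadratic_le_coarse (d : StepData ε m M L G X Y Z) (c₁ c₂ : ℝ) :
    ∫ ξ : ℝ × ℝ, (c₁ * ξ.1 + c₂ * ξ.2) ^ 2 * G ξ ∂planeGauss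
      ≤ M / m * (c₁ ^ 2 + c₂ ^ 2) * ∫ ξ, G ξ ∂planeGauss := by
  have tl : Tame fun ξ : ℝ × ℝ => (c₁ * ξ.1 + c₂ * ξ.2) ^ 2 :=
    ((Tame.fst.const_mul _).add (Tame.snd.const_mul _)).pow 2
  have h := (tl.mul d.tame).integral_mono (tl.const_mul M) fun ξ => by
    rw [mul_comm M]
    exact mul_le_mul_of_nonneg_left (d.upper ξ) (sq_nonneg _)
  rw [integral_const_mul, planeGauss_integral_sq] at h
  refine h.trans ?_
  have : M / m * (c₁ ^ 2 + c₂ ^ 2) * m = M * (c₁ ^ 2 + c₂ ^ 2) := by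
    have := d.pos.ne'
    field_simp
  rw [← this]
  have := d.pos
  have := d.M_pos
  exact mul_le_mul_of_nonneg_left d.mean_ge (by positivity)

/-- Fine comparison of weighted quadratic forms, for functions of small oscillation. -/
lemma quadratic_le_fine (d : StepData ε m M L G X Y Z) {k : ℝ} (hk : 0 ≤ k)
    (hosc : ∀ ξ, |G ξ - ∫ ξ, G ξ ∂planeGauss| ≤ ε * k * (1 + ‖ξ‖)) (c₁ c₂ : ℝ) :
    ∫ ξ : ℝ × ℝ, (c₁ * ξ.1 + c₂ * ξ.2) ^ 2 * G ξ ∂planeGauss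
      ≤ (1 + ε * (2 * k * weightMoment 3 / m)) * (c₁ ^ 2 + c₂ ^ 2) * ∫ ξ, G ξ ∂planeGauss := by
  have h0 := d.eps_nonneg
  have hm := d.pos
  have hpm := d.mean_ge
  set p := ∫ ξ, G ξ ∂planeGauss with hp
  have tl : Tame fun ξ : ℝ × ℝ => (c₁ * ξ.1 + c₂ * ξ.2) ^ 2 :=
    ((Tame.fst.const_mul _).add (Tame.snd.const_mul _)).pow 2
  have t3 := (Tame.weight_pow 3).const_mul (2 * (c₁ ^ 2 + c₂ ^ 2) * (ε * k))
  have h := (tl.mul d.tame).integral_mono ((tl.const_mul p).add t3) fun ξ => by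
    have e1 : G ξ ≤ p + ε * k * (1 + ‖ξ‖) := by linarith [(abs_le.1 (hosc ξ)).2]
    have e2 : (c₁ * ξ.1 + c₂ * ξ.2) ^ 2 ≤ 2 * (c₁ ^ 2 + c₂ ^ 2) * (1 + ‖ξ‖) ^ 2 := by
      have ha := sq_le_sq' (abs_le.1 (abs_fst_le_weight ξ)).1 (abs_le.1 (abs_fst_le_weight ξ)).2
      have hb := sq_le_sq' (abs_le.1 (abs_snd_le_weight ξ)).1 (abs_le.1 (abs_snd_le_weight ξ)).2
      have hc : (c₁ * ξ.1 + c₂ * ξ.2) ^ 2 ≤ (c₁ ^ 2 + c₂ ^ 2) * (ξ.1 ^ 2 + ξ.2 ^ 2) := by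
        nlinarith [sq_nonneg (c₁ * ξ.2 - c₂ * ξ.1)]
      nlinarith [mul_le_mul_of_nonneg_left (add_le_add ha hb)
        (by positivity : 0 ≤ c₁ ^ 2 + c₂ ^ 2)]
    have e3 := mul_le_mul_of_nonneg_left e1 (sq_nonneg (c₁ * ξ.1 + c₂ * ξ.2))
    have e4 := mul_le_mul_of_nonneg_right e2 (by positivity : 0 ≤ ε * k * (1 + ‖ξ‖))
    calc _ ≤ _ := e3
      _ = p * (c₁ * ξ.1 + c₂ * ξ.2) ^ 2 + (c₁ * ξ.1 + c₂ * ξ.2) ^ 2 * (ε * k * (1 + ‖ξ‖)) := by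
        ring
      _ ≤ _ := by rw [pow_succ (1 + ‖ξ‖) 2]; linarith
  rw [(tl.const_mul p).integral_add t3, integral_const_mul, integral_const_mul,
    planeGauss_integral_sq] at h
  refine h.trans ?_
  change p * (c₁ ^ 2 + c₂ ^ 2) + 2 * (c₁ ^ 2 + c₂ ^ 2) * (ε * k) * weightMoment 3 ≤ _
  have hw := weightMoment_nonneg 3
  have e5 : 2 * (c₁ ^ 2 + c₂ ^ 2) * (ε * k) * weightMoment 3
      = ε * (2 * k * weightMoment 3 / m) * (c₁ ^ 2 + c₂ ^ 2) * m := by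
    field_simp
  have e6 := mul_le_mul_of_nonneg_left hpm
    (by positivity : 0 ≤ ε * (2 * k * weightMoment 3 / m) * (c₁ ^ 2 + c₂ ^ 2))
  rw [e5]
  linarith

end StepData

end PlaneStep
/-! ### Entropy of one step -/

section EntropyStep

/-- Third-order upper Taylor bound for the logarithm. -/
lemma log_one_add_le_cubic {u : ℝ} (hu : -1 < u) :
    Real.log (1 + u) ≤ u - u ^ 2 / 2 + u ^ 3 / 3 := by
  set f : ℝ → ℝ := fun u => u - u ^ 2 / 2 + u ^ 3 / 3 - Real.log (1 + u) with hf
  have hd : ∀ v, -1 < v → HasDerivAt f (v ^ 3 / (1 + v)) v := by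
    intro v hv
    have hv' : 1 + v ≠ 0 := by linarith
    have h1 := (((hasDerivAt_id v).sub (((hasDerivAt_id v).pow 2).div_const 2)).add
      (((hasDerivAt_id v).pow 3).div_const 3)).sub (((hasDerivAt_id v).const_add 1).log hv')
    refine h1.congr_deriv ?_
    simp only [id]
    field_simp
    ring
  have hf0 : f 0 = 0 := by simp [hf]
  have hmem : 0 ≤ f u := by
    rw [← hf0]
    rcases le_total 0 u with h | h
    · refine monotoneOn_of_deriv_nonneg (convex_Ici (0 : ℝ)) ?_ ?_ ?_ Set.self_mem_Ici h h
      · exact fun v hv => (hd v (by linarith [Set.mem_Ici.1 hv])).continuousAt.continuousWithinAt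
      · intro v hv
        rw [interior_Ici, Set.mem_Ioi] at hv
        exact (hd v (by linarith)).differentiableAt.differentiableWithinAt
      · intro v hv
        rw [interior_Ici, Set.mem_Ioi] at hv
        rw [(hd v (by linarith)).deriv]
        positivity
    · refine antitoneOn_of_deriv_nonpos (convex_Ioc (-1 : ℝ) 0) ?_ ?_ ?_ ⟨hu, h⟩
        ⟨by norm_num, le_rfl⟩ h
      · exact fun v hv => (hd v hv.1).continuousAt.continuousWithinAt
      · intro v hv
        rw [interior_Ioc] at hv
        exact (hd v hv.1).differentiableAt.differentiableWithinAt
      · intro v hv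
        rw [interior_Ioc] at hv
        rw [(hd v hv.1).deriv]
        have h1 : v ^ 3 ≤ 0 := by nlinarith [hv.2, sq_nonneg v]
        exact div_nonpos_of_nonpos_of_nonneg h1 (by linarith [hv.1])
  simp only [hf] at hmem
  linarith

/-- Fourth-order upper bound for `y log y` around `p`. -/
lemma mul_log_le_quartic {p y : ℝ} (hp : 0 < p) (hy : 0 < y) :
    y * Real.log y ≤ y * Real.log p + (y - p) + (y - p) ^ 2 / (2 * p)
      + p * (|(y - p) / p| ^ 3 / 6 + |(y - p) / p| ^ 4 / 3) := by
  set u := (y - p) / p with hu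
  have hy' : y = p * (1 + u) := by rw [hu]; field_simp; ring
  have h1 : 0 < 1 + u := by
    by_contra h
    nlinarith
  have hl := log_one_add_le_cubic (by linarith : -1 < u)
  have h3 : -u ^ 3 ≤ |u| ^ 3 := by rw [← abs_pow]; exact neg_le_abs _
  have h4 : |u| ^ 4 = u ^ 4 := by rw [← abs_pow, abs_of_nonneg (by positivity)]
  have e2 : (y - p) ^ 2 / (2 * p) = p * (u ^ 2 / 2) := by rw [hu]; field_simp
  have e1 : y - p = p * u := by rw [hu]; field_simp
  have hlog : Real.log y = Real.log p + Real.log (1 + u) := by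
    rw [hy', Real.log_mul hp.ne' h1.ne']
  rw [hlog, e2, e1, h4]
  have key := mul_le_mul_of_nonneg_left hl hy.le
  have : y * (u - u ^ 2 / 2 + u ^ 3 / 3) = p * (u + u ^ 2 / 2 - u ^ 3 / 6 + u ^ 4 / 3) := by
    rw [hy']; ring
  nlinarith

/-- The constant of the one-step entropy estimate. -/
def entropyConst (m M L k : ℝ) : ℝ :=
  M * ((k / m) ^ 3 / 6 + (k / m) ^ 4 / 3) * weightMoment 4 + L ^ 2 * k / m ^ 2 * weightMoment 1
    + 3 / 2 * (L ^ 2 / m) * weightMoment 2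

namespace StepData

variable {ε m M L : ℝ} {G X Y Z : ℝ × ℝ → ℝ}

/-- The variance of one step is controlled by the horizontal gradient. -/
lemma variance_le (d : StepData ε m M L G X Y Z) :
    ∫ ξ, (G ξ - ∫ ξ, G ξ ∂planeGauss) ^ 2 ∂planeGauss
      ≤ ε ^ 2 * (∫ ξ, (X ξ ^ 2 + Y ξ ^ 2) ∂planeGauss + 3 * ε * L ^ 2 * weightMoment 2) := by
  have h0 := d.eps_nonneg
  have h1 := d.eps_le_one
  have hL := d.L_nonneg
  have := d.contX
  have := d.contY
  have := d.contZ
  have tX : Tame fun ξ => ε * (X ξ + ε / 2 * ξ.2 * Z ξ) :=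
    (d.tameX.add ((Tame.snd.const_mul (ε / 2)).mul d.tameZ)).const_mul ε
  have tY : Tame fun ξ => ε * (Y ξ - ε / 2 * ξ.1 * Z ξ) :=
    (d.tameY.sub ((Tame.fst.const_mul (ε / 2)).mul d.tameZ)).const_mul ε
  have hp := planeGauss_poincare (F₁ := fun ξ => ε * (X ξ + ε / 2 * ξ.2 * Z ξ))
    (F₂ := fun ξ => ε * (Y ξ - ε / 2 * ξ.1 * Z ξ)) (C := M + L)
    d.cont (by fun_prop) (by fun_prop) d.deriv_fst d.deriv_snd
    (fun ξ => (d.abs_G_le ξ).trans (by linarith)) d.abs_partial_fst_le d.abs_partial_snd_le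
  rw [integral_sub_const_sq _ d.tame.integrable (d.tame.pow 2).integrable]
  have t1 := (d.tameX.pow 2).add (d.tameY.pow 2)
  have t2 := (Tame.weight_pow 2).const_mul (3 * ε * L ^ 2)
  have key := ((tX.pow 2).add (tY.pow 2)).integral_mono ((t1.add t2).const_mul (ε ^ 2))
    fun ξ => by
      have hw : 1 ≤ 1 + ‖ξ‖ := by linarith [norm_nonneg ξ]
      have aux : ∀ x b z : ℝ, |x| ≤ L → |z| ≤ L → |b| ≤ 1 + ‖ξ‖ →
          (x + ε / 2 * b * z) ^ 2 ≤ x ^ 2 + 3 / 2 * ε * L ^ 2 * (1 + ‖ξ‖) ^ 2 := by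
        intro x b z hx hz hb
        set w := 1 + ‖ξ‖ with hw'
        clear_value w
        have q1 : |b * x * z| ≤ L ^ 2 * w ^ 2 := by
          rw [abs_mul, abs_mul]
          calc |b| * |x| * |z| ≤ w * L * L := by gcongr
            _ ≤ w * L * L * w := le_mul_of_one_le_right (by positivity) hw
            _ = _ := by ring
        have q2 : (b * z) ^ 2 ≤ L ^ 2 * w ^ 2 := by
          rw [← sq_abs, abs_mul, ← mul_pow, mul_comm L]
          gcongr
        have q3 := mul_le_mul_of_nonneg_left (abs_le.1 q1).2 h0
        have q4 := mul_le_mul_of_nonneg_left q2 (by positivity : 0 ≤ ε ^ 2 / 4)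
        have q5 : ε ^ 2 / 4 * (L ^ 2 * w ^ 2) ≤ ε / 4 * (L ^ 2 * w ^ 2) :=
          mul_le_mul_of_nonneg_right (by nlinarith) (by positivity)
        have q6 : 0 ≤ ε * L ^ 2 * w ^ 2 := by positivity
        nlinarith
      have a1 := aux _ _ _ (d.boundX ξ) (d.boundZ ξ) (abs_snd_le_weight ξ)
      have a2 := aux (Y ξ) (-ξ.1) (Z ξ) (d.boundY ξ) (d.boundZ ξ)
        (by rw [abs_neg]; exact abs_fst_le_weight ξ)
      have e : Y ξ - ε / 2 * ξ.1 * Z ξ = Y ξ + ε / 2 * -ξ.1 * Z ξ := by ring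
      rw [e, mul_pow, mul_pow, ← mul_add]
      exact mul_le_mul_of_nonneg_left (by linarith) (sq_nonneg ε)
  rw [integral_const_mul, t1.integral_add t2, integral_const_mul] at key
  change _ ≤ ε ^ 2 * (_ + 3 * ε * L ^ 2 * weightMoment 2) at key
  have hsq : ∀ p : ℝ, ∫ ξ, G ξ ^ 2 ∂planeGauss - 2 * p * p + p ^ 2
      = ∫ ξ, G ξ ^ 2 ∂planeGauss - p ^ 2 := fun p => by ring
  rw [hsq]
  exact hp.trans key

/-- The entropy created by one step of the walk. -/
lemma entropy_step (d : StepData ε m M L G X Y Z) {k : ℝ} (hk : 0 ≤ k)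
    (hosc : ∀ ξ, |G ξ - ∫ ξ, G ξ ∂planeGauss| ≤ ε * k * (1 + ‖ξ‖)) :
    ∫ ξ, G ξ * Real.log (G ξ) ∂planeGauss
        - (∫ ξ, G ξ ∂planeGauss) * Real.log (∫ ξ, G ξ ∂planeGauss)
      ≤ ε ^ 2 / 2 * ∫ ξ, (X ξ ^ 2 + Y ξ ^ 2) / G ξ ∂planeGauss
        + entropyConst m M L k * ε ^ 3 := by
  have h0 := d.eps_nonneg
  have h1 := d.eps_le_one
  have hL := d.L_nonneg
  have hm := d.pos
  have hpm := d.mean_ge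
  have hpM := d.mean_le
  have hvar := d.variance_le
  set p := ∫ ξ, G ξ ∂planeGauss with hp
  have hp0 : 0 < p := hm.trans_le hpm
  clear_value p
  have tG := d.tame
  have tlog : Tame fun ξ => G ξ * Real.log (G ξ) := by
    refine tG.mul (.of_bounded (d.cont.log fun ξ => (d.G_pos ξ).ne')
      (C := |Real.log m| + |Real.log M|) fun ξ => ?_)
    have l1 := Real.log_le_log hm (d.lower ξ)
    have l2 := Real.log_le_log (d.G_pos ξ) (d.upper ξ)
    rw [abs_le]
    constructor
    · linarith [neg_abs_le (Real.log m), abs_nonneg (Real.log M)]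
    · linarith [le_abs_self (Real.log M), abs_nonneg (Real.log m)]
  have ta := tG.const_mul (Real.log p)
  have tb := tG.sub (Tame.const p)
  have tc := (tb.pow 2).const_mul (1 / (2 * p))
  have te := (Tame.weight_pow 4).const_mul
    (M * ((k / m) ^ 3 / 6 + (k / m) ^ 4 / 3) * ε ^ 3)
  have key := tlog.integral_mono (((ta.add tb).add tc).add te) fun ξ => by
    have hG := d.G_pos ξ
    have h := mul_log_le_quartic hp0 hG
    have hw : 1 ≤ 1 + ‖ξ‖ := by linarith [norm_nonneg ξ]
    have hu : |(G ξ - p) / p| ≤ ε * (k / m) * (1 + ‖ξ‖) := by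
      rw [abs_div, abs_of_pos hp0, div_le_iff₀ hp0]
      refine (hosc ξ).trans ?_
      have : ε * k * (1 + ‖ξ‖) = ε * (k / m) * (1 + ‖ξ‖) * m := by field_simp
      rw [this]
      exact mul_le_mul_of_nonneg_left hpm (by positivity)
    set w := 1 + ‖ξ‖
    set κ := k / m
    have hκ : 0 ≤ κ := by positivity
    have u3 : |(G ξ - p) / p| ^ 3 ≤ ε ^ 3 * κ ^ 3 * w ^ 4 :=
      calc |(G ξ - p) / p| ^ 3 ≤ (ε * κ * w) ^ 3 := by gcongr
        _ = ε ^ 3 * κ ^ 3 * w ^ 3 := by ring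
        _ ≤ _ := by gcongr; norm_num
    have u4 : |(G ξ - p) / p| ^ 4 ≤ ε ^ 3 * κ ^ 4 * w ^ 4 :=
      calc |(G ξ - p) / p| ^ 4 ≤ (ε * κ * w) ^ 4 := by gcongr
        _ = ε ^ 4 * κ ^ 4 * w ^ 4 := by ring
        _ ≤ _ := by
          gcongr ?_ * κ ^ 4 * w ^ 4
          exact pow_le_pow_of_le_one h0 h1 (by norm_num)
    have u5 : p * (|(G ξ - p) / p| ^ 3 / 6 + |(G ξ - p) / p| ^ 4 / 3)
        ≤ M * (κ ^ 3 / 6 + κ ^ 4 / 3) * ε ^ 3 * w ^ 4 :=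
      calc _ ≤ M * (ε ^ 3 * κ ^ 3 * w ^ 4 / 6 + ε ^ 3 * κ ^ 4 * w ^ 4 / 3) := by
            gcongr
            exact d.M_pos.le
        _ = _ := by ring
    have u6 : 1 / (2 * p) * (G ξ - p) ^ 2 = (G ξ - p) ^ 2 / (2 * p) := by ring
    rw [u6]
    linarith
  rw [((ta.add tb).add tc).integral_add te, (ta.add tb).integral_add tc, ta.integral_add tb,
    tG.integral_sub (Tame.const p), integral_const_mul, integral_const_mul, integral_const_mul,
    ← hp] at key
  change _ ≤ _ + M * ((k / m) ^ 3 / 6 + (k / m) ^ 4 / 3) * ε ^ 3 * weightMoment 4 at key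
  simp only [integral_const, probReal_univ, one_smul, sub_self, add_zero] at key
  -- replace the average by the function itself in the denominator
  have tX := (d.tameX.pow 2).add (d.tameY.pow 2)
  have tN := (d.tame_div tX)
  have tw := (Tame.weight_pow 1).const_mul (2 * L ^ 2 * ε * k / m ^ 2)
  have hN := (tX.const_mul (1 / p)).integral_mono (tN.add tw) fun ξ => by
    have hG := d.G_pos ξ
    have e : 1 / p * (X ξ ^ 2 + Y ξ ^ 2)
        = (X ξ ^ 2 + Y ξ ^ 2) / G ξ + (X ξ ^ 2 + Y ξ ^ 2) * (G ξ - p) / (p * G ξ) := by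
      field_simp; ring
    rw [e]
    refine add_le_add_right ?_ _
    have hX := sq_le_sq' (abs_le.1 (d.boundX ξ)).1 (abs_le.1 (d.boundX ξ)).2
    have hY := sq_le_sq' (abs_le.1 (d.boundY ξ)).1 (abs_le.1 (d.boundY ξ)).2
    have hG' := d.lower ξ
    calc (X ξ ^ 2 + Y ξ ^ 2) * (G ξ - p) / (p * G ξ)
        ≤ (X ξ ^ 2 + Y ξ ^ 2) * (ε * k * (1 + ‖ξ‖)) / (p * G ξ) := by
          gcongr
          exact (abs_le.1 (hosc ξ)).2
      _ ≤ (2 * L ^ 2) * (ε * k * (1 + ‖ξ‖)) / (m * m) := by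
          gcongr
          linarith
      _ = _ := by field_simp
  rw [tN.integral_add tw, integral_const_mul, integral_const_mul] at hN
  change _ ≤ _ + 2 * L ^ 2 * ε * k / m ^ 2 * weightMoment 1 at hN
  set V := ∫ ξ, (G ξ - p) ^ 2 ∂planeGauss
  set S := ∫ ξ, (X ξ ^ 2 + Y ξ ^ 2) ∂planeGauss
  set T := ∫ ξ, (X ξ ^ 2 + Y ξ ^ 2) / G ξ ∂planeGauss
  have hV : 1 / (2 * p) * V ≤ ε ^ 2 / 2 * (1 / p * S + 3 * ε * (L ^ 2 / m) * weightMoment 2) := by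
    have hw := weightMoment_nonneg 2
    calc 1 / (2 * p) * V ≤ 1 / (2 * p) * (ε ^ 2 * (S + 3 * ε * L ^ 2 * weightMoment 2)) := by
          gcongr
      _ = ε ^ 2 / 2 * (1 / p * S + 3 * ε * (L ^ 2 / p) * weightMoment 2) := by field_simp
      _ ≤ _ := by gcongr
  have hN' := mul_le_mul_of_nonneg_left hN (by positivity : 0 ≤ ε ^ 2 / 2)
  have : entropyConst m M L k * ε ^ 3
      = M * ((k / m) ^ 3 / 6 + (k / m) ^ 4 / 3) * ε ^ 3 * weightMoment 4
        + ε ^ 2 / 2 * (2 * L ^ 2 * ε * k / m ^ 2 * weightMoment 1)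
        + ε ^ 2 / 2 * (3 * ε * (L ^ 2 / m) * weightMoment 2) := by
    rw [entropyConst]; ring
  rw [this]
  linarith

end StepData

end EntropyStep
/-! ### The Heisenberg random walk -/

section Walk

/-- One step of size `ε` of the Heisenberg walk, started at `h`, with increment `ξ`. -/
def step (ε : ℝ) (h : H) (ξ : ℝ × ℝ) : H :=
  (h.1 + ε * ξ.1, h.2.1 + ε * ξ.2, h.2.2 + ε / 2 * (h.1 * ξ.2 - h.2.1 * ξ.1))

/-- The Markov operator of the Heisenberg walk with Gaussian steps of size `ε`. -/
def walkOp (ε : ℝ) (g : H → ℝ) (h : H) : ℝ := ∫ ξ, g (step ε h ξ) ∂planeGauss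

/-- The left-invariant vector field `X = ∂x - (y/2) ∂z`. -/
def dX (g : H → ℝ) (h : H) : ℝ := fderiv ℝ g h (1, 0, -h.2.1 / 2)

/-- The left-invariant vector field `Y = ∂y + (x/2) ∂z`. -/
def dY (g : H → ℝ) (h : H) : ℝ := fderiv ℝ g h (0, 1, h.1 / 2)

/-- The central vector field `Z = ∂z`. -/
def dZ (g : H → ℝ) (h : H) : ℝ := fderiv ℝ g h (0, 0, 1)

lemma fderiv_eq_frame (g : H → ℝ) (h v : H) :
    fderiv ℝ g h v = v.1 * dX g h + v.2.1 * dY g h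
      + (v.2.2 + v.1 * h.2.1 / 2 - v.2.1 * h.1 / 2) * dZ g h := by
  have e : v = v.1 • ((1, 0, -h.2.1 / 2) : H) + v.2.1 • ((0, 1, h.1 / 2) : H)
      + (v.2.2 + v.1 * h.2.1 / 2 - v.2.1 * h.1 / 2) • ((0, 0, 1) : H) := by
    ext <;> simp
    ring
  conv_lhs => rw [e]
  simp only [map_add, map_smul, smul_eq_mul, dX, dY, dZ]

@[fun_prop]
lemma continuous_step_left (ε : ℝ) (ξ : ℝ × ℝ) : Continuous fun h => step ε h ξ := by
  unfold step; fun_prop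

@[fun_prop]
lemma continuous_step_right (ε : ℝ) (h : H) : Continuous fun ξ => step ε h ξ := by
  unfold step; fun_prop

/-- A `C¹` function with values in `[m, M]` and left-invariant derivatives bounded by `L`. -/
structure Nice (m M L : ℝ) (g : H → ℝ) : Prop where
  pos : 0 < m
  contDiff : ContDiff ℝ 1 g
  lower : ∀ h, m ≤ g h
  upper : ∀ h, g h ≤ M
  boundX : ∀ h, |dX g h| ≤ L
  boundY : ∀ h, |dY g h| ≤ L
  boundZ : ∀ h, |dZ g h| ≤ L

lemma abs_fst_le_norm (h : H) : |h.1| ≤ ‖h‖ := norm_fst_le h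

lemma abs_snd_le_norm (h : H) : |h.2.1| ≤ ‖h‖ := (norm_fst_le h.2).trans (norm_snd_le h)

lemma abs_thd_le_norm (h : H) : |h.2.2| ≤ ‖h‖ := (norm_snd_le h.2).trans (norm_snd_le h)

lemma norm_le_of_abs_le {h : H} {c : ℝ} (h₁ : |h.1| ≤ c) (h₂ : |h.2.1| ≤ c) (h₃ : |h.2.2| ≤ c) :
    ‖h‖ ≤ c := by
  rw [Prod.norm_def, Prod.norm_def]
  exact max_le h₁ (max_le h₂ h₃)

lemma abs_twist_le {ε : ℝ} (h0 : 0 ≤ ε) (h1 : ε ≤ 1) (h : H) (ξ : ℝ × ℝ) :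
    |ε / 2 * (h.1 * ξ.2 - h.2.1 * ξ.1)| ≤ ‖h‖ * ‖ξ‖ := by
  have e1 : |h.1 * ξ.2 - h.2.1 * ξ.1| ≤ 2 * (‖h‖ * ‖ξ‖) := by
    refine (abs_sub _ _).trans ?_
    rw [abs_mul, abs_mul]
    have := mul_le_mul (abs_fst_le_norm h) (norm_snd_le ξ) (norm_nonneg _) (norm_nonneg _)
    have := mul_le_mul (abs_snd_le_norm h) (norm_fst_le ξ) (norm_nonneg _) (norm_nonneg _)
    simp only [Real.norm_eq_abs] at *
    linarith
  rw [abs_mul, abs_of_nonneg (by positivity : 0 ≤ ε / 2)]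
  have : 0 ≤ ‖h‖ * ‖ξ‖ := by positivity
  nlinarith

lemma one_add_norm_step_le {ε : ℝ} (h0 : 0 ≤ ε) (h1 : ε ≤ 1) (h : H) (ξ : ℝ × ℝ) :
    1 + ‖step ε h ξ‖ ≤ (1 + ‖h‖) * (1 + ‖ξ‖) := by
  have hh := norm_nonneg h
  have hx := norm_nonneg ξ
  have hp : 0 ≤ ‖h‖ * ‖ξ‖ := by positivity
  have aux : ∀ u v : ℝ, |u| ≤ ‖h‖ → |v| ≤ ‖ξ‖ → |u + ε * v| ≤ ‖h‖ + ‖ξ‖ + ‖h‖ * ‖ξ‖ := by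
    intro u v hu hv
    refine (abs_add_le _ _).trans ?_
    rw [abs_mul, abs_of_nonneg h0]
    nlinarith [abs_nonneg v]
  have : ‖step ε h ξ‖ ≤ ‖h‖ + ‖ξ‖ + ‖h‖ * ‖ξ‖ := by
    refine norm_le_of_abs_le (aux _ _ (abs_fst_le_norm h) (norm_fst_le ξ))
      (aux _ _ (abs_snd_le_norm h) (norm_snd_le ξ)) ?_
    refine (abs_add_le _ _).trans ?_
    linarith [abs_thd_le_norm h, abs_twist_le h0 h1 h ξ]
  linarith

/-- The linear part of the step map in its base point. -/
def stepLin (ε : ℝ) (ξ : ℝ × ℝ) : H →L[ℝ] H :=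
  ContinuousLinearMap.id ℝ H
    + (ε / 2 * ξ.2) • (ContinuousLinearMap.inr ℝ ℝ (ℝ × ℝ)).comp
        ((ContinuousLinearMap.inr ℝ ℝ ℝ).comp (ContinuousLinearMap.fst ℝ ℝ (ℝ × ℝ)))
    - (ε / 2 * ξ.1) • (ContinuousLinearMap.inr ℝ ℝ (ℝ × ℝ)).comp
        ((ContinuousLinearMap.inr ℝ ℝ ℝ).comp
          ((ContinuousLinearMap.fst ℝ ℝ ℝ).comp (ContinuousLinearMap.snd ℝ ℝ (ℝ × ℝ))))

lemma stepLin_apply (ε : ℝ) (ξ : ℝ × ℝ) (v : H) :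
    stepLin ε ξ v = (v.1, v.2.1, v.2.2 + ε / 2 * (v.1 * ξ.2 - v.2.1 * ξ.1)) := by
  ext <;> simp [stepLin]
  ring

@[fun_prop]
lemma continuous_stepLin (ε : ℝ) : Continuous (stepLin ε) := by
  unfold stepLin; fun_prop

lemma hasFDerivAt_step (ε : ℝ) (h : H) (ξ : ℝ × ℝ) :
    HasFDerivAt (fun h => step ε h ξ) (stepLin ε ξ) h := by
  have e : (fun h => step ε h ξ) = fun h => stepLin ε ξ h + ((ε * ξ.1, ε * ξ.2, 0) : H) := by
    ext h <;> simp [step, stepLin_apply]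
  rw [e]
  exact (stepLin ε ξ).hasFDerivAt.add_const _

lemma norm_stepLin_le {ε : ℝ} (h0 : 0 ≤ ε) (h1 : ε ≤ 1) (ξ : ℝ × ℝ) :
    ‖stepLin ε ξ‖ ≤ 1 + ‖ξ‖ := by
  refine ContinuousLinearMap.opNorm_le_bound _ (by positivity) fun v => ?_
  rw [stepLin_apply]
  have hv : 0 ≤ ‖v‖ * ‖ξ‖ := by positivity
  refine norm_le_of_abs_le ?_ ?_ ?_
  · linarith [abs_fst_le_norm v]
  · linarith [abs_snd_le_norm v]
  · refine (abs_add_le _ _).trans ?_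
    linarith [abs_thd_le_norm v, abs_twist_le h0 h1 v ξ]

namespace Nice

variable {ε m M L : ℝ} {g : H → ℝ}

lemma L_nonneg (hg : Nice m M L g) : 0 ≤ L := (abs_nonneg _).trans (hg.boundX 0)

lemma M_pos (hg : Nice m M L g) : 0 < M := hg.pos.trans_le ((hg.lower 0).trans (hg.upper 0))

lemma g_pos (hg : Nice m M L g) (h : H) : 0 < g h := hg.pos.trans_le (hg.lower h)

lemma abs_g_le (hg : Nice m M L g) (h : H) : |g h| ≤ M := by
  rw [abs_of_pos (hg.g_pos h)]; exact hg.upper h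

lemma cont (hg : Nice m M L g) : Continuous g := hg.contDiff.continuous

lemma cont_fderiv (hg : Nice m M L g) : Continuous (fderiv ℝ g) :=
  hg.contDiff.continuous_fderiv one_ne_zero

lemma hasFDerivAt (hg : Nice m M L g) (h : H) : HasFDerivAt g (fderiv ℝ g h) h :=
  (hg.contDiff.differentiable (by norm_num) h).hasFDerivAt

lemma contX (hg : Nice m M L g) : Continuous (dX g) :=
  hg.cont_fderiv.clm_apply (by fun_prop)

lemma contY (hg : Nice m M L g) : Continuous (dY g) :=
  hg.cont_fderiv.clm_apply (by fun_prop)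

lemma contZ (hg : Nice m M L g) : Continuous (dZ g) :=
  hg.cont_fderiv.clm_apply (by fun_prop)

lemma norm_fderiv_le (hg : Nice m M L g) (h : H) : ‖fderiv ℝ g h‖ ≤ 3 * L * (1 + ‖h‖) := by
  have hL := hg.L_nonneg
  refine ContinuousLinearMap.opNorm_le_bound _ (by positivity) fun v => ?_
  rw [fderiv_eq_frame]
  have hv := norm_nonneg v
  have hh := norm_nonneg h
  have b1 : |v.1 * dX g h| ≤ ‖v‖ * L := by
    rw [abs_mul]; exact mul_le_mul (abs_fst_le_norm v) (hg.boundX h) (abs_nonneg _) hv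
  have b2 : |v.2.1 * dY g h| ≤ ‖v‖ * L := by
    rw [abs_mul]; exact mul_le_mul (abs_snd_le_norm v) (hg.boundY h) (abs_nonneg _) hv
  have b3 : |(v.2.2 + v.1 * h.2.1 / 2 - v.2.1 * h.1 / 2) * dZ g h| ≤ (‖v‖ + ‖v‖ * ‖h‖) * L := by
    rw [abs_mul]
    refine mul_le_mul ?_ (hg.boundZ h) (abs_nonneg _) (by positivity)
    have c1 : |v.1 * h.2.1| ≤ ‖v‖ * ‖h‖ := by
      rw [abs_mul]; exact mul_le_mul (abs_fst_le_norm v) (abs_snd_le_norm h) (abs_nonneg _) hv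
    have c2 : |v.2.1 * h.1| ≤ ‖v‖ * ‖h‖ := by
      rw [abs_mul]; exact mul_le_mul (abs_snd_le_norm v) (abs_fst_le_norm h) (abs_nonneg _) hv
    have c3 := abs_le.1 (abs_thd_le_norm v)
    rw [abs_le] at c1 c2 ⊢
    constructor <;> linarith [c1.1, c1.2, c2.1, c2.2, c3.1, c3.2]
  have b4 : 0 ≤ ‖v‖ * ‖h‖ * L := by positivity
  rw [Real.norm_eq_abs]
  refine ((abs_add_le _ _).trans (add_le_add_left (abs_add_le _ _) _)).trans ?_
  linarith

/-- The derivatives of the increment map of the walk. -/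
lemma stepData (hg : Nice m M L g) (h0 : 0 ≤ ε) (h1 : ε ≤ 1) (h : H) :
    StepData ε m M L (fun ξ => g (step ε h ξ)) (fun ξ => dX g (step ε h ξ))
      (fun ξ => dY g (step ε h ξ)) (fun ξ => dZ g (step ε h ξ)) where
  eps_nonneg := h0
  eps_le_one := h1
  pos := hg.pos
  cont := hg.cont.comp (by fun_prop)
  contX := hg.contX.comp (by fun_prop)
  contY := hg.contY.comp (by fun_prop)
  contZ := hg.contZ.comp (by fun_prop)
  lower _ := hg.lower _
  upper _ := hg.upper _
  boundX _ := hg.boundX _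
  boundY _ := hg.boundY _
  boundZ _ := hg.boundZ _
  deriv_fst a b := by
    have hs : HasDerivAt (fun t => step ε h (t, b)) ((ε, 0, -(ε / 2 * h.2.1)) : H) a := by
      simp only [step]
      refine HasDerivAt.prodMk ?_ (HasDerivAt.prodMk (hasDerivAt_const _ _) ?_)
      · simpa using ((hasDerivAt_id a).const_mul ε).const_add h.1
      · simpa using ((((hasDerivAt_id a).const_mul h.2.1).const_sub (h.1 * b)).const_mul
          (ε / 2)).const_add h.2.2
    refine ((hg.hasFDerivAt _).comp_hasDerivAt a hs).congr_deriv ?_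
    rw [fderiv_eq_frame]
    simp only [step]
    ring
  deriv_snd a b := by
    have hs : HasDerivAt (fun t => step ε h (a, t)) ((0, ε, ε / 2 * h.1) : H) b := by
      simp only [step]
      refine HasDerivAt.prodMk (hasDerivAt_const _ _) (HasDerivAt.prodMk ?_ ?_)
      · simpa using ((hasDerivAt_id b).const_mul ε).const_add h.2.1
      · simpa using ((((hasDerivAt_id b).const_mul h.1).sub_const (h.2.1 * a)).const_mul
          (ε / 2)).const_add h.2.2
    refine ((hg.hasFDerivAt _).comp_hasDerivAt b hs).congr_deriv ?_
    rw [fderiv_eq_frame]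
    simp only [step]
    ring

/-- Functions with bounded left-invariant derivatives vary slowly along the walk. -/
lemma abs_step_sub_le (hg : Nice m M L g) (h0 : 0 ≤ ε) (h : H) (ξ : ℝ × ℝ) :
    |g (step ε h ξ) - g h| ≤ ε * (2 * L) * ‖ξ‖ := by
  have hd : ∀ t : ℝ, HasDerivAt (fun t : ℝ => g (step ε h (t • ξ)))
      (ε * (ξ.1 * dX g (step ε h (t • ξ)) + ξ.2 * dY g (step ε h (t • ξ)))) t := by
    intro t
    have hs : HasDerivAt (fun t : ℝ => step ε h (t • ξ))
        ((ε * ξ.1, ε * ξ.2, ε / 2 * (h.1 * ξ.2 - h.2.1 * ξ.1)) : H) t := by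
      have e : (fun t : ℝ => step ε h (t • ξ)) = fun t : ℝ =>
          h + t • ((ε * ξ.1, ε * ξ.2, ε / 2 * (h.1 * ξ.2 - h.2.1 * ξ.1)) : H) := by
        ext t <;> simp [step] <;> ring
      rw [e]
      simpa using ((hasDerivAt_id t).smul_const
        ((ε * ξ.1, ε * ξ.2, ε / 2 * (h.1 * ξ.2 - h.2.1 * ξ.1)) : H)).const_add h
    refine ((hg.hasFDerivAt _).comp_hasDerivAt t hs).congr_deriv ?_
    rw [fderiv_eq_frame]
    simp only [step, Prod.smul_fst, Prod.smul_snd, smul_eq_mul]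
    ring
  have hb : ∀ t : ℝ, ‖ε * (ξ.1 * dX g (step ε h (t • ξ)) + ξ.2 * dY g (step ε h (t • ξ)))‖
      ≤ ε * (2 * L) * ‖ξ‖ := by
    intro t
    have b1 : |ξ.1 * dX g (step ε h (t • ξ))| ≤ ‖ξ‖ * L := by
      rw [abs_mul]; exact mul_le_mul (norm_fst_le ξ) (hg.boundX _) (abs_nonneg _) (norm_nonneg _)
    have b2 : |ξ.2 * dY g (step ε h (t • ξ))| ≤ ‖ξ‖ * L := by
      rw [abs_mul]; exact mul_le_mul (norm_snd_le ξ) (hg.boundY _) (abs_nonneg _) (norm_nonneg _)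
    rw [Real.norm_eq_abs, abs_mul, abs_of_nonneg h0, mul_assoc]
    refine mul_le_mul_of_nonneg_left ((abs_add_le _ _).trans ?_) h0
    linarith
  have := norm_image_sub_le_of_norm_deriv_le_segment_01'
    (f := fun t : ℝ => g (step ε h (t • ξ))) (fun t _ => (hd t).hasDerivWithinAt)
    (fun t _ => hb t)
  have e0 : step ε h ((0 : ℝ) • ξ) = h := by simp [step]
  simpa only [one_smul, e0, Real.norm_eq_abs] using this

/-- The oscillation constant of functions with left-invariant derivatives bounded by `L`. -/
lemma abs_step_sub_walkOp_le (hg : Nice m M L g) (h0 : 0 ≤ ε) (h1 : ε ≤ 1) (h : H)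
    (ξ : ℝ × ℝ) :
    |g (step ε h ξ) - walkOp ε g h| ≤ ε * (2 * L * (1 + weightMoment 1)) * (1 + ‖ξ‖) := by
  have hL := hg.L_nonneg
  have hw := weightMoment_nonneg 1
  have t := (hg.stepData h0 h1 h).tame
  have e1 := hg.abs_step_sub_le h0 h ξ
  have e2 : |walkOp ε g h - g h| ≤ ε * (2 * L) * weightMoment 1 := by
    have ts := t.sub (Tame.const (g h))
    have : walkOp ε g h - g h = ∫ ξ, (g (step ε h ξ) - g h) ∂planeGauss := by
      rw [t.integral_sub (Tame.const _)]
      simp [walkOp]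
    rw [this]
    refine abs_integral_le_integral_abs.trans ?_
    rw [weightMoment, ← integral_const_mul]
    refine integral_mono ts.integrable.abs ((Tame.weight_pow 1).const_mul _).integrable
      fun ξ => (hg.abs_step_sub_le h0 h ξ).trans ?_
    simp only [pow_one]
    exact mul_le_mul_of_nonneg_left (by linarith) (by positivity)
  have e3 : |g (step ε h ξ) - walkOp ε g h|
      ≤ |g (step ε h ξ) - g h| + |walkOp ε g h - g h| := by
    have := abs_sub (g (step ε h ξ) - g h) (walkOp ε g h - g h)
    simpa using this
  have hx := norm_nonneg ξ
  have e4 : 0 ≤ ε * (2 * L) * weightMoment 1 * ‖ξ‖ := by positivity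
  have e5 : 0 ≤ ε * (2 * L) := by positivity
  nlinarith

end Nice

end Walk
/-! ### Regularity of the Markov operator -/

section WalkRegularity

/-- Bounded continuous functions on the Heisenberg group. -/
def BddCont (φ : H → ℝ) : Prop := Continuous φ ∧ ∃ C, ∀ h, |φ h| ≤ C

namespace BddCont

variable {φ ψ : H → ℝ} {ε : ℝ}

lemma const (c : ℝ) : BddCont fun _ => c := ⟨continuous_const, |c|, fun _ => le_rfl⟩

lemma add (hφ : BddCont φ) (hψ : BddCont ψ) : BddCont fun h => φ h + ψ h := by
  obtain ⟨hc, C, hC⟩ := hφ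
  obtain ⟨hd, D, hD⟩ := hψ
  exact ⟨hc.add hd, C + D, fun h => (abs_add_le _ _).trans (add_le_add (hC h) (hD h))⟩

lemma mul (hφ : BddCont φ) (hψ : BddCont ψ) : BddCont fun h => φ h * ψ h := by
  obtain ⟨hc, C, hC⟩ := hφ
  obtain ⟨hd, D, hD⟩ := hψ
  refine ⟨hc.mul hd, C * D, fun h => ?_⟩
  rw [abs_mul]
  exact mul_le_mul (hC h) (hD h) (abs_nonneg _) ((abs_nonneg _).trans (hC h))

lemma const_mul (hφ : BddCont φ) (c : ℝ) : BddCont fun h => c * φ h := (const c).mul hφ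

lemma sub (hφ : BddCont φ) (hψ : BddCont ψ) : BddCont fun h => φ h - ψ h := by
  simpa [sub_eq_add_neg] using hφ.add (hψ.const_mul (-1))

lemma tame_step (hφ : BddCont φ) (ε : ℝ) (h : H) : Tame fun ξ => φ (step ε h ξ) := by
  obtain ⟨hc, C, hC⟩ := hφ
  exact .of_bounded (hc.comp (by fun_prop)) fun ξ => hC _

lemma walkOp (hφ : BddCont φ) (ε : ℝ) : BddCont (walkOp ε φ) := by
  have ht := hφ.tame_step ε
  obtain ⟨hc, C, hC⟩ := hφ
  refine ⟨continuous_of_dominated (bound := fun _ => C)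
    (fun h => (ht h).integrable.aestronglyMeasurable)
    (fun h => Filter.Eventually.of_forall fun ξ => hC _) (integrable_const _)
    (Filter.Eventually.of_forall fun ξ => hc.comp (by fun_prop)), C, fun h => ?_⟩
  have := norm_integral_le_of_norm_le_const (μ := planeGauss) (f := fun ξ => φ (step ε h ξ))
    (C := C) (Filter.Eventually.of_forall fun ξ => hC _)
  simpa [_root_.walkOp] using this

lemma iterate (hφ : BddCont φ) (ε : ℝ) (n : ℕ) : BddCont ((_root_.walkOp ε)^[n] φ) := by
  induction n with
  | zero => exact hφ
  | succ n ih => rw [Function.iterate_succ_apply']; exact ih.walkOp ε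

lemma walkOp_add (hφ : BddCont φ) (hψ : BddCont ψ) (h : H) :
    _root_.walkOp ε (fun h => φ h + ψ h) h = _root_.walkOp ε φ h + _root_.walkOp ε ψ h :=
  (hφ.tame_step ε h).integral_add (hψ.tame_step ε h)

lemma walkOp_sub (hφ : BddCont φ) (hψ : BddCont ψ) (h : H) :
    _root_.walkOp ε (fun h => φ h - ψ h) h = _root_.walkOp ε φ h - _root_.walkOp ε ψ h :=
  (hφ.tame_step ε h).integral_sub (hψ.tame_step ε h)

lemma walkOp_mono (hφ : BddCont φ) (hψ : BddCont ψ) (hle : ∀ h, φ h ≤ ψ h) (h : H) :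
    _root_.walkOp ε φ h ≤ _root_.walkOp ε ψ h :=
  (hφ.tame_step ε h).integral_mono (hψ.tame_step ε h) fun _ => hle _

end BddCont

lemma walkOp_const_mul (ε c : ℝ) (φ : H → ℝ) (h : H) :
    walkOp ε (fun h => c * φ h) h = c * walkOp ε φ h := integral_const_mul _ _

lemma walkOp_const (ε c : ℝ) (h : H) : walkOp ε (fun _ => c) h = c := by simp [walkOp]

namespace Nice

variable {ε m M L : ℝ} {g : H → ℝ}

lemma bddCont (hg : Nice m M L g) : BddCont g := ⟨hg.cont, M, hg.abs_g_le⟩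

lemma norm_fderiv_step_le (hg : Nice m M L g) (h0 : 0 ≤ ε) (h1 : ε ≤ 1) (h : H) (ξ : ℝ × ℝ) :
    ‖(fderiv ℝ g (step ε h ξ)).comp (stepLin ε ξ)‖ ≤ 3 * L * (1 + ‖h‖) * (1 + ‖ξ‖) ^ 2 := by
  have hL := hg.L_nonneg
  calc _ ≤ ‖fderiv ℝ g (step ε h ξ)‖ * ‖stepLin ε ξ‖ := ContinuousLinearMap.opNorm_comp_le _ _
    _ ≤ (3 * L * (1 + ‖step ε h ξ‖)) * (1 + ‖ξ‖) := by
        gcongr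
        · exact hg.norm_fderiv_le _
        · exact norm_stepLin_le h0 h1 ξ
    _ ≤ (3 * L * ((1 + ‖h‖) * (1 + ‖ξ‖))) * (1 + ‖ξ‖) := by
        gcongr
        exact one_add_norm_step_le h0 h1 h ξ
    _ = _ := by ring

lemma continuous_fderiv_step (hg : Nice m M L g) (h : H) :
    Continuous fun ξ => (fderiv ℝ g (step ε h ξ)).comp (stepLin ε ξ) :=
  (hg.cont_fderiv.comp (continuous_step_right ε h)).clm_comp (continuous_stepLin ε)

lemma integrable_fderiv_step (hg : Nice m M L g) (h0 : 0 ≤ ε) (h1 : ε ≤ 1) (h : H) :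
    Integrable (fun ξ => (fderiv ℝ g (step ε h ξ)).comp (stepLin ε ξ)) planeGauss :=
  ((Tame.weight_pow 2).const_mul (3 * L * (1 + ‖h‖))).integrable.mono'
    (hg.continuous_fderiv_step h).aestronglyMeasurable
    (Filter.Eventually.of_forall (hg.norm_fderiv_step_le h0 h1 h))

lemma norm_fderiv_step_le_of_mem_ball (hg : Nice m M L g) (h0 : 0 ≤ ε) (h1 : ε ≤ 1) {h h' : H}
    (hh : h' ∈ Metric.ball h 1) (ξ : ℝ × ℝ) :
    ‖(fderiv ℝ g (step ε h' ξ)).comp (stepLin ε ξ)‖ ≤ 3 * L * (2 + ‖h‖) * (1 + ‖ξ‖) ^ 2 := by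
  have hL := hg.L_nonneg
  refine (hg.norm_fderiv_step_le h0 h1 h' ξ).trans ?_
  gcongr 3 * L * ?_ * (1 + ‖ξ‖) ^ 2
  have := norm_lt_of_mem_ball hh
  linarith

lemma hasFDerivAt_walkOp (hg : Nice m M L g) (h0 : 0 ≤ ε) (h1 : ε ≤ 1) (h : H) :
    HasFDerivAt (walkOp ε g)
      (∫ ξ, (fderiv ℝ g (step ε h ξ)).comp (stepLin ε ξ) ∂planeGauss) h := by
  refine hasFDerivAt_integral_of_dominated_of_fderiv_le (Metric.ball_mem_nhds h one_pos)
    (F' := fun h ξ => (fderiv ℝ g (step ε h ξ)).comp (stepLin ε ξ))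
    (bound := fun ξ => 3 * L * (2 + ‖h‖) * (1 + ‖ξ‖) ^ 2) ?_ ?_ ?_ ?_ ?_ ?_
  · exact Filter.Eventually.of_forall fun h' =>
      (hg.bddCont.tame_step ε h').integrable.aestronglyMeasurable
  · exact (hg.bddCont.tame_step ε h).integrable
  · exact (hg.continuous_fderiv_step h).aestronglyMeasurable
  · exact Filter.Eventually.of_forall fun ξ h' hh =>
      hg.norm_fderiv_step_le_of_mem_ball h0 h1 hh ξ
  · exact ((Tame.weight_pow 2).const_mul _).integrable
  · exact Filter.Eventually.of_forall fun ξ h' _ =>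
      (hg.hasFDerivAt _).comp h' (hasFDerivAt_step ε h' ξ)

lemma contDiff_walkOp (hg : Nice m M L g) (h0 : 0 ≤ ε) (h1 : ε ≤ 1) :
    ContDiff ℝ 1 (walkOp ε g) := by
  rw [contDiff_one_iff_fderiv]
  refine ⟨fun h => (hg.hasFDerivAt_walkOp h0 h1 h).differentiableAt, ?_⟩
  have e : fderiv ℝ (walkOp ε g)
      = fun h => ∫ ξ, (fderiv ℝ g (step ε h ξ)).comp (stepLin ε ξ) ∂planeGauss :=
    funext fun h => (hg.hasFDerivAt_walkOp h0 h1 h).fderiv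
  rw [e, continuous_iff_continuousAt]
  intro h
  refine continuousAt_of_dominated
    (bound := fun ξ => 3 * L * (2 + ‖h‖) * (1 + ‖ξ‖) ^ 2) ?_ ?_ ?_ ?_
  · exact Filter.Eventually.of_forall fun h' =>
      (hg.continuous_fderiv_step h').aestronglyMeasurable
  · filter_upwards [Metric.ball_mem_nhds h one_pos] with h' hh
    exact Filter.Eventually.of_forall (hg.norm_fderiv_step_le_of_mem_ball h0 h1 hh)
  · exact ((Tame.weight_pow 2).const_mul _).integrable
  · exact Filter.Eventually.of_forall fun ξ =>
      ((hg.cont_fderiv.comp (continuous_step_left ε ξ)).clm_comp continuous_const).continuousAt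

lemma fderiv_walkOp_apply (hg : Nice m M L g) (h0 : 0 ≤ ε) (h1 : ε ≤ 1) (h v : H) :
    fderiv ℝ (walkOp ε g) h v = ∫ ξ, fderiv ℝ g (step ε h ξ) (stepLin ε ξ v) ∂planeGauss := by
  rw [(hg.hasFDerivAt_walkOp h0 h1 h).fderiv,
    ContinuousLinearMap.integral_apply (hg.integrable_fderiv_step h0 h1 h)]
  rfl

lemma dX_walkOp (hg : Nice m M L g) (h0 : 0 ≤ ε) (h1 : ε ≤ 1) (h : H) :
    dX (walkOp ε g) h
      = ∫ ξ, (dX g (step ε h ξ) + ε * ξ.2 * dZ g (step ε h ξ)) ∂planeGauss := by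
  rw [dX, hg.fderiv_walkOp_apply h0 h1]
  congr 1; ext ξ
  rw [fderiv_eq_frame, stepLin_apply]
  simp only [step]
  ring

lemma dY_walkOp (hg : Nice m M L g) (h0 : 0 ≤ ε) (h1 : ε ≤ 1) (h : H) :
    dY (walkOp ε g) h
      = ∫ ξ, (dY g (step ε h ξ) - ε * ξ.1 * dZ g (step ε h ξ)) ∂planeGauss := by
  rw [dY, hg.fderiv_walkOp_apply h0 h1]
  congr 1; ext ξ
  rw [fderiv_eq_frame, stepLin_apply]
  simp only [step]
  ring

lemma dZ_walkOp (hg : Nice m M L g) (h0 : 0 ≤ ε) (h1 : ε ≤ 1) (h : H) :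
    dZ (walkOp ε g) h = ∫ ξ, dZ g (step ε h ξ) ∂planeGauss := by
  rw [dZ, hg.fderiv_walkOp_apply h0 h1]
  congr 1; ext ξ
  rw [fderiv_eq_frame, stepLin_apply]
  simp only [step]
  ring

/-- The Markov operator preserves the class of nice functions. -/
lemma walkOp_nice (hg : Nice m M L g) (h0 : 0 ≤ ε) (h1 : ε ≤ 1) :
    Nice m M (2 * L * weightMoment 1) (walkOp ε g) := by
  have hL := hg.L_nonneg
  have bound : ∀ F : ℝ × ℝ → ℝ, (∀ ξ, |F ξ| ≤ 2 * L * (1 + ‖ξ‖) ^ 1) →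
      |∫ ξ, F ξ ∂planeGauss| ≤ 2 * L * weightMoment 1 := by
    intro F hF
    rw [weightMoment, ← integral_const_mul]
    exact norm_integral_le_of_norm_le (f := F) ((Tame.weight_pow 1).const_mul (2 * L)).integrable
      (Filter.Eventually.of_forall hF)
  have aux : ∀ b z ξ, |b| ≤ ‖ξ‖ → |z| ≤ L → |ε * b * z| ≤ L * ‖(ξ : ℝ × ℝ)‖ := by
    intro b z ξ hb hz
    rw [abs_mul, abs_mul, abs_of_nonneg h0, mul_comm L]
    refine mul_le_mul ?_ hz (abs_nonneg _) (norm_nonneg _)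
    nlinarith [abs_nonneg b]
  refine ⟨hg.pos, hg.contDiff_walkOp h0 h1, fun h => (hg.stepData h0 h1 h).mean_ge,
    fun h => (hg.stepData h0 h1 h).mean_le, fun h => ?_, fun h => ?_, fun h => ?_⟩
  · rw [hg.dX_walkOp h0 h1]
    refine bound _ fun ξ => (abs_add_le _ _).trans ?_
    have := mul_nonneg hL (norm_nonneg ξ)
    linarith [hg.boundX (step ε h ξ), aux _ _ ξ (norm_snd_le ξ) (hg.boundZ (step ε h ξ))]
  · rw [hg.dY_walkOp h0 h1]
    refine bound _ fun ξ => (abs_sub _ _).trans ?_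
    have := mul_nonneg hL (norm_nonneg ξ)
    linarith [hg.boundY (step ε h ξ), aux _ _ ξ (norm_fst_le ξ) (hg.boundZ (step ε h ξ))]
  · rw [hg.dZ_walkOp h0 h1]
    refine bound _ fun ξ => (hg.boundZ _).trans ?_
    have := mul_nonneg hL (norm_nonneg ξ)
    linarith

end Nice

end WalkRegularity

/-! ### The discrete Baudoin–Garofalo argument -/

section Chain

/-- Horizontal Fisher information density. -/
def hFisher (g : H → ℝ) (h : H) : ℝ := (dX g h ^ 2 + dY g h ^ 2) / g h

/-- Vertical Fisher information density. -/
def vFisher (g : H → ℝ) (h : H) : ℝ := dZ g h ^ 2 / g h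

namespace Nice

variable {ε m M L : ℝ} {g : H → ℝ}

lemma hFisher_nonneg (hg : Nice m M L g) (h : H) : 0 ≤ hFisher g h := by
  have := hg.g_pos h
  unfold hFisher; positivity

lemma vFisher_nonneg (hg : Nice m M L g) (h : H) : 0 ≤ vFisher g h := by
  have := hg.g_pos h
  unfold vFisher; positivity

lemma bddCont_inv (hg : Nice m M L g) : BddCont fun h => (g h)⁻¹ := by
  refine ⟨hg.cont.inv₀ fun h => (hg.g_pos h).ne', m⁻¹, fun h => ?_⟩
  rw [abs_of_pos (inv_pos.2 (hg.g_pos h))]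
  exact inv_anti₀ hg.pos (hg.lower h)

lemma bddCont_hFisher (hg : Nice m M L g) : BddCont (hFisher g) := by
  have hX : BddCont (dX g) := ⟨hg.contX, L, hg.boundX⟩
  have hY : BddCont (dY g) := ⟨hg.contY, L, hg.boundY⟩
  have := ((hX.mul hX).add (hY.mul hY)).mul hg.bddCont_inv
  unfold hFisher
  simpa only [div_eq_mul_inv, pow_two] using this

lemma bddCont_vFisher (hg : Nice m M L g) : BddCont (vFisher g) := by
  have hZ : BddCont (dZ g) := ⟨hg.contZ, L, hg.boundZ⟩
  have := (hZ.mul hZ).mul hg.bddCont_inv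
  unfold vFisher
  simpa only [div_eq_mul_inv, pow_two] using this

lemma bddCont_mul_log (hg : Nice m M L g) : BddCont fun h => g h * Real.log (g h) := by
  refine hg.bddCont.mul ⟨hg.cont.log fun h => (hg.g_pos h).ne',
    |Real.log m| + |Real.log M|, fun h => ?_⟩
  have l1 := Real.log_le_log hg.pos (hg.lower h)
  have l2 := Real.log_le_log (hg.g_pos h) (hg.upper h)
  rw [abs_le]
  constructor
  · linarith [neg_abs_le (Real.log m), abs_nonneg (Real.log M)]
  · linarith [le_abs_self (Real.log M), abs_nonneg (Real.log m)]

lemma vFisher_walkOp_le (hg : Nice m M L g) (h0 : 0 ≤ ε) (h1 : ε ≤ 1) (h : H) :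
    vFisher (walkOp ε g) h ≤ walkOp ε (vFisher g) h := by
  have d := hg.stepData h0 h1 h
  rw [vFisher, hg.dZ_walkOp h0 h1, div_le_iff₀ (show 0 < walkOp ε g h from d.mean_pos), mul_comm]
  exact d.sq_integral_le_mul d.tameZ

lemma hFisher_walkOp_le (hg : Nice m M L g) (h0 : 0 ≤ ε) (h1 : ε ≤ 1) {R s : ℝ} (hR : 0 < R)
    (hs : 0 < s) (h : H)
    (hq : ∀ c₁ c₂ : ℝ, ∫ ξ : ℝ × ℝ, (c₁ * ξ.1 + c₂ * ξ.2) ^ 2 * g (step ε h ξ) ∂planeGauss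
      ≤ R * (c₁ ^ 2 + c₂ ^ 2) * walkOp ε g h) :
    hFisher (walkOp ε g) h ≤ (1 + s * ε ^ 2) * walkOp ε (hFisher g) h
      + (ε ^ 2 + 1 / s) * R * (walkOp ε (vFisher g) h - vFisher (walkOp ε g) h) := by
  have := (hg.stepData h0 h1 h).gradient_step hR hs hq
  rw [hFisher, vFisher, hg.dX_walkOp h0 h1, hg.dY_walkOp h0 h1, hg.dZ_walkOp h0 h1]
  exact this

/-- A bound on the Fisher information grows by a factor at most `1 + ε²` in one step. -/
lemma fisher_walkOp_le (hg : Nice m M L g) (h0 : 0 ≤ ε) (h1 : ε ≤ 1) {Λ : ℝ}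
    (hΛ : ∀ h, hFisher g h + 2 * M / m * vFisher g h ≤ Λ) (h : H) :
    hFisher (walkOp ε g) h + 2 * M / m * vFisher (walkOp ε g) h ≤ (1 + ε ^ 2) * Λ := by
  have hm := hg.pos
  have hM := hg.M_pos
  have hR : 0 < M / m := by positivity
  have e1 := hg.hFisher_walkOp_le h0 h1 hR one_pos h (hg.stepData h0 h1 h).quadratic_le_coarse
  have e2 := hg.vFisher_walkOp_le h0 h1 h
  have hN := hg.bddCont_hFisher
  have hV := hg.bddCont_vFisher
  have e3 := (hN.add (hV.const_mul (2 * M / m))).walkOp_mono (BddCont.const Λ) (ε := ε) hΛ h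
  rw [hN.walkOp_add (hV.const_mul _), walkOp_const_mul, walkOp_const] at e3
  set n' := hFisher (walkOp ε g) h
  set v' := vFisher (walkOp ε g) h
  set pn := walkOp ε (hFisher g) h
  set pv := walkOp ε (vFisher g) h
  have hv' : 0 ≤ v' := (hg.walkOp_nice h0 h1).vFisher_nonneg h
  have hε : ε ^ 2 ≤ 1 := pow_le_one₀ h0 h1
  have e4 : (ε ^ 2 + 1 / 1) * (M / m) * (pv - v') ≤ 2 * M / m * (pv - v') := by
    have : 2 * M / m = 2 * (M / m) := by ring
    rw [this]
    exact mul_le_mul_of_nonneg_right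
      (mul_le_mul_of_nonneg_right (by linarith) hR.le) (by linarith)
  have e5 : 0 ≤ ε ^ 2 * (2 * M / m * pv) := by
    have : 0 ≤ pv := hv'.trans e2
    positivity
  have e6 := mul_le_mul_of_nonneg_left e3 (by positivity : 0 ≤ 1 + ε ^ 2)
  linarith

/-- Left-invariant derivatives are controlled by the Fisher information. -/
lemma of_fisher_le (hg : Nice m M L g) {Λ : ℝ}
    (hΛ : ∀ h, hFisher g h + 2 * M / m * vFisher g h ≤ Λ) : Nice m M (√(Λ * M)) g := by
  have hm := hg.pos
  have hM := hg.M_pos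
  have hmM : m ≤ M := (hg.lower 0).trans (hg.upper 0)
  have aux : ∀ h u, u ^ 2 / g h ≤ Λ → |u| ≤ √(Λ * M) := by
    intro h u hu
    have hgp := hg.g_pos h
    rw [← Real.sqrt_sq_eq_abs]
    refine Real.sqrt_le_sqrt ?_
    have h0 : 0 ≤ u ^ 2 / g h := by positivity
    calc u ^ 2 = u ^ 2 / g h * g h := by field_simp
      _ ≤ Λ * M := mul_le_mul hu (hg.upper h) hgp.le (h0.trans hu)
  have hQ : 1 ≤ 2 * M / m := by rw [one_le_div hm]; linarith
  refine ⟨hg.pos, hg.contDiff, hg.lower, hg.upper, fun h => aux h _ ?_, fun h => aux h _ ?_,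
    fun h => aux h _ ?_⟩
  all_goals
    have hgp := hg.g_pos h
    have hv := hg.vFisher_nonneg h
    have hn := hg.hFisher_nonneg h
    have hx : 0 ≤ dX g h ^ 2 / g h := by positivity
    have hy : 0 ≤ dY g h ^ 2 / g h := by positivity
    have hsum : hFisher g h = dX g h ^ 2 / g h + dY g h ^ 2 / g h := add_div _ _ _
    have hz : vFisher g h = dZ g h ^ 2 / g h := rfl
    have hh := hΛ h
    nlinarith

/-- Iterates of the Markov operator stay uniformly nice up to time one. -/
lemma exists_iterate_nice (hg : Nice m M L g) :
    ∃ L', ∀ (ε : ℝ) (n j : ℕ), 0 ≤ ε → ε ≤ 1 → n * ε ^ 2 ≤ 1 → j ≤ n →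
      Nice m M L' ((walkOp ε)^[j] g) := by
  obtain ⟨Λ, hΛ⟩ : ∃ Λ, ∀ h, hFisher g h + 2 * M / m * vFisher g h ≤ Λ := by
    obtain ⟨-, C, hC⟩ := hg.bddCont_hFisher.add (hg.bddCont_vFisher.const_mul (2 * M / m))
    exact ⟨C, fun h => (le_abs_self _).trans (hC h)⟩
  have hm := hg.pos
  have hM := hg.M_pos
  have hΛ0 : 0 ≤ Λ := by
    have h1 := hg.vFisher_nonneg 0
    have h2 := hg.hFisher_nonneg 0
    exact le_trans (by positivity) (hΛ 0)
  refine ⟨√(Real.exp 1 * Λ * M), fun ε n j h0 h1 hn hj => ?_⟩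
  have key : ∀ j : ℕ, (∃ K, Nice m M K ((walkOp ε)^[j] g)) ∧
      ∀ h, hFisher ((walkOp ε)^[j] g) h + 2 * M / m * vFisher ((walkOp ε)^[j] g) h
        ≤ (1 + ε ^ 2) ^ j * Λ := by
    intro j
    induction j with
    | zero => exact ⟨⟨L, hg⟩, by simpa using hΛ⟩
    | succ j ih =>
      obtain ⟨⟨K, hK⟩, hb⟩ := ih
      rw [Function.iterate_succ_apply']
      refine ⟨⟨_, hK.walkOp_nice h0 h1⟩, fun h => (hK.fisher_walkOp_le h0 h1 hb h).trans ?_⟩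
      rw [pow_succ]
      exact le_of_eq (by ring)
  obtain ⟨⟨K, hK⟩, hb⟩ := key j
  refine hK.of_fisher_le fun h => (hb h).trans ?_
  refine mul_le_mul_of_nonneg_right ?_ hΛ0
  have hj' : (j : ℝ) * ε ^ 2 ≤ 1 :=
    (mul_le_mul_of_nonneg_right (Nat.cast_le.2 hj) (sq_nonneg ε)).trans hn
  calc (1 + ε ^ 2) ^ j ≤ Real.exp (ε ^ 2) ^ j := by
        gcongr
        linarith [Real.add_one_le_exp (ε ^ 2)]
    _ = Real.exp (j * ε ^ 2) := by rw [← Real.exp_nat_mul]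
    _ ≤ Real.exp 1 := Real.exp_le_exp.2 hj'

end Nice

end Chain
/-! ### Entropy of the walk -/

section WalkEntropy

namespace Nice

variable {ε m M L : ℝ} {g : H → ℝ}

/-- The remainder constant in the comparison of quadratic forms along the walk. -/
def _root_.quadConst (m L : ℝ) : ℝ := 2 * (2 * L * (1 + weightMoment 1)) * weightMoment 3 / m

/-- One step of the discrete Baudoin–Garofalo argument. -/
lemma entropy_walkOp_le (hg : Nice m M L g) (h0 : 0 ≤ ε) (h1 : ε ≤ 1) {ν a B : ℝ} (hν : 0 < ν)
    (ha : 0 ≤ a) (hB : a * ((ν + ε ^ 2) * (1 + ε * quadConst m L)) ≤ B) (h : H) :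
    walkOp ε (fun h => g h * Real.log (g h)) h - walkOp ε g h * Real.log (walkOp ε g h)
        + a * hFisher (walkOp ε g) h + B * vFisher (walkOp ε g) h
      ≤ ((1 + ε ^ 2 / ν) * a + ε ^ 2 / 2) * walkOp ε (hFisher g) h
        + B * walkOp ε (vFisher g) h
        + entropyConst m M L (2 * L * (1 + weightMoment 1)) * ε ^ 3 := by
  have hm := hg.pos
  have hL := hg.L_nonneg
  have hw1 := weightMoment_nonneg 1
  have hw3 := weightMoment_nonneg 3
  have d := hg.stepData h0 h1 h
  have hosc := hg.abs_step_sub_walkOp_le h0 h1 h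
  have hk : 0 ≤ 2 * L * (1 + weightMoment 1) := by positivity
  have hR : 0 < 1 + ε * quadConst m L := by unfold quadConst; positivity
  have e1 := d.entropy_step hk hosc
  have e2 := hg.hFisher_walkOp_le h0 h1 hR (inv_pos.2 hν) h (d.quadratic_le_fine hk hosc)
  have e3 := hg.vFisher_walkOp_le h0 h1 h
  change walkOp ε (fun h => g h * Real.log (g h)) h - walkOp ε g h * Real.log (walkOp ε g h)
    ≤ ε ^ 2 / 2 * walkOp ε (hFisher g) h + _ at e1
  have e4 := mul_le_mul_of_nonneg_left e2 ha
  have e5 := mul_le_mul_of_nonneg_right hB (sub_nonneg.2 e3)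
  have e6 : ε ^ 2 + 1 / ν⁻¹ = ν + ε ^ 2 := by rw [one_div, inv_inv, add_comm]
  rw [e6] at e4
  have e7 : ε ^ 2 / ν = ν⁻¹ * ε ^ 2 := by rw [div_eq_inv_mul]
  rw [e7]
  linarith

end Nice

/-- The solution of the recursion `α (i + 1) = (1 + ε² / ν) α i + ε² / 2`, `α 0 = 0`. -/
def entropyWeight (ν ε : ℝ) (i : ℕ) : ℝ := ν / 2 * ((1 + ε ^ 2 / ν) ^ i - 1)

lemma entropyWeight_succ {ν : ℝ} (hν : 0 < ν) (ε : ℝ) (i : ℕ) :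
    entropyWeight ν ε (i + 1) = (1 + ε ^ 2 / ν) * entropyWeight ν ε i + ε ^ 2 / 2 := by
  simp only [entropyWeight, pow_succ]
  field_simp
  ring

lemma entropyWeight_mono {ν : ℝ} (hν : 0 < ν) (ε : ℝ) : Monotone (entropyWeight ν ε) := by
  intro i j hij
  have h1 : 1 ≤ 1 + ε ^ 2 / ν := by linarith [(by positivity : 0 ≤ ε ^ 2 / ν)]
  unfold entropyWeight
  have := pow_le_pow_right₀ h1 hij
  gcongr

lemma entropyWeight_zero (ν ε : ℝ) : entropyWeight ν ε 0 = 0 := by simp [entropyWeight]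

lemma entropyWeight_le {ν : ℝ} (hν : 0 < ν) {ε : ℝ} {n : ℕ} (hn : n * ε ^ 2 ≤ 1) :
    entropyWeight ν ε n ≤ ν / 2 * (Real.exp (1 / ν) - 1) := by
  unfold entropyWeight
  gcongr
  calc (1 + ε ^ 2 / ν) ^ n ≤ Real.exp (ε ^ 2 / ν) ^ n := by
        gcongr
        linarith [Real.add_one_le_exp (ε ^ 2 / ν)]
    _ = Real.exp (n * ε ^ 2 / ν) := by rw [← Real.exp_nat_mul, mul_div_assoc]
    _ ≤ Real.exp (1 / ν) := Real.exp_le_exp.2 (by gcongr)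

namespace Nice

variable {m M L : ℝ} {g : H → ℝ}

/-- The logarithmic Sobolev inequality for the walk, with an error of order `n ε³`. -/
lemma walk_entropy_le (hg : Nice m M L g) {ν : ℝ} (hν : 0 < ν) :
    ∃ C K : ℝ, 0 ≤ K ∧ ∀ (ε : ℝ) (n : ℕ), 0 ≤ ε → ε ≤ 1 → n * ε ^ 2 ≤ 1 → ∀ h,
      (walkOp ε)^[n] (fun h => g h * Real.log (g h)) h
          - (walkOp ε)^[n] g h * Real.log ((walkOp ε)^[n] g h)
        ≤ ν / 2 * (Real.exp (1 / ν) - 1) * ((walkOp ε)^[n] (hFisher g) h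
          + (ν + ε ^ 2) * (1 + ε * K) * (walkOp ε)^[n] (vFisher g) h) + n * (C * ε ^ 3) := by
  obtain ⟨L', hL'⟩ := hg.exists_iterate_nice
  have hL0 : Nice m M L' g := hL' 0 0 0 le_rfl zero_le_one (by simp) le_rfl
  set C := entropyConst m M L' (2 * L' * (1 + weightMoment 1))
  have hK : 0 ≤ quadConst m L' := by
    have := hL0.L_nonneg
    have := weightMoment_nonneg 1
    have := weightMoment_nonneg 3
    have := hg.pos
    unfold quadConst; positivity
  refine ⟨C, quadConst m L', hK, fun ε n h0 h1 hn h => ?_⟩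
  set α := entropyWeight ν ε with hα
  have hα0 : ∀ i, 0 ≤ α i := fun i => by
    rw [← entropyWeight_zero ν ε]; exact entropyWeight_mono hν ε (Nat.zero_le i)
  set S := (ν + ε ^ 2) * (1 + ε * quadConst m L') with hS
  have hS0 : 0 ≤ S := by positivity
  set B := α n * S with hB
  set φ : H → ℝ := fun h => g h * Real.log (g h) with hφ
  have bφ := hg.bddCont_mul_log
  have bN := hg.bddCont_hFisher
  have bV := hg.bddCont_vFisher
  have key : ∀ j : ℕ, j ≤ n → ∀ h, (walkOp ε)^[j] φ h
      - (walkOp ε)^[j] g h * Real.log ((walkOp ε)^[j] g h)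
      + α (n - j) * hFisher ((walkOp ε)^[j] g) h + B * vFisher ((walkOp ε)^[j] g) h
      ≤ α n * (walkOp ε)^[j] (hFisher g) h + B * (walkOp ε)^[j] (vFisher g) h
        + j * (C * ε ^ 3) := by
    intro j
    induction j with
    | zero => intro _ h; simp [hφ]
    | succ j ih =>
      intro hj h
      have ih := ih (by omega)
      have hgj := hL' ε n j h0 h1 hn (by omega)
      simp only [Function.iterate_succ_apply']
      have bφj := bφ.iterate ε j
      have bNj := bN.iterate ε j
      have bVj := bV.iterate ε j
      set gj := (walkOp ε)^[j] g
      have hsub : n - j = n - (j + 1) + 1 := by omega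
      have hstep := hgj.entropy_walkOp_le h0 h1 hν (hα0 (n - (j + 1)))
        (B := B) (mul_le_mul_of_nonneg_right
          (entropyWeight_mono hν ε (Nat.sub_le n (j + 1))) hS0) h
      have hrec := entropyWeight_succ hν ε (n - (j + 1))
      rw [← hsub, ← hα] at hrec
      rw [← hrec] at hstep
      have c1 := bφj.sub hgj.bddCont_mul_log
      have c2 := hgj.bddCont_hFisher.const_mul (α (n - j))
      have c3 := hgj.bddCont_vFisher.const_mul B
      have d1 := bNj.const_mul (α n)
      have d2 := bVj.const_mul B
      have hmono := ((c1.add c2).add c3).walkOp_mono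
        ((d1.add d2).add (BddCont.const (j * (C * ε ^ 3)))) (ε := ε) ih h
      rw [(c1.add c2).walkOp_add c3, c1.walkOp_add c2, bφj.walkOp_sub hgj.bddCont_mul_log,
        (d1.add d2).walkOp_add (BddCont.const _), d1.walkOp_add d2, walkOp_const_mul,
        walkOp_const_mul, walkOp_const_mul, walkOp_const_mul, walkOp_const] at hmono
      push_cast
      linarith
  have hfin := key n le_rfl h
  have hgn := hL' ε n n h0 h1 hn le_rfl
  rw [Nat.sub_self, hα, entropyWeight_zero, zero_mul, add_zero, ← hα] at hfin
  have hBv : 0 ≤ B * vFisher ((walkOp ε)^[n] g) h :=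
    mul_nonneg (mul_nonneg (hα0 n) hS0) (hgn.vFisher_nonneg h)
  have iter_nonneg : ∀ {ψ : H → ℝ}, (∀ h, 0 ≤ ψ h) → ∀ h, 0 ≤ (walkOp ε)^[n] ψ h := by
    intro ψ hψ
    have : ∀ j : ℕ, ∀ h, 0 ≤ (walkOp ε)^[j] ψ h := by
      intro j
      induction j with
      | zero => exact hψ
      | succ j ih =>
        intro h
        rw [Function.iterate_succ_apply']
        exact integral_nonneg fun ξ => ih _
    exact this n
  have hNn := iter_nonneg hg.hFisher_nonneg h
  have hVn := iter_nonneg hg.vFisher_nonneg h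
  have hle := mul_le_mul_of_nonneg_right (entropyWeight_le hν hn)
    (add_nonneg hNn (mul_nonneg hS0 hVn))
  have e : α n * ((walkOp ε)^[n] (hFisher g) h + S * (walkOp ε)^[n] (vFisher g) h)
      = α n * (walkOp ε)^[n] (hFisher g) h + B * (walkOp ε)^[n] (vFisher g) h := by
    rw [hB]; ring
  rw [← hα, e] at hle
  linarith

end Nice

end WalkEntropy
/-! ### The random walk and its law -/

section WalkLaw

instance : IsProbabilityMeasure stdGauss3 := by unfold stdGauss3; infer_instance

instance (n : ℕ) : IsProbabilityMeasure (gaussN n) := by unfold gaussN; infer_instance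

lemma measurePreserving_horizontal :
    MeasurePreserving (fun v : H => (v.1, v.2.1)) stdGauss3 planeGauss :=
  (MeasurePreserving.id _).prod measurePreserving_fst

/-- The endpoint of the walk started at `h` with increments `v` scaled by `ε`. -/
def walkEnd (ε : ℝ) (h : H) {k : ℕ} (v : Fin k → H) : H :=
  (h.1 + ε * ∑ i, (v i).1, h.2.1 + ε * ∑ i, (v i).2.1,
    h.2.2 + ε / 2 * (h.1 * ∑ i, (v i).2.1 - h.2.1 * ∑ i, (v i).1)
      + ε ^ 2 / 2 * ∑ i, ∑ j, if i < j then (v i).1 * (v j).2.1 - (v i).2.1 * (v j).1 else 0)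

lemma walkEnd_succ (ε : ℝ) (h : H) {k : ℕ} (v : Fin (k + 1) → H) :
    walkEnd ε h v = walkEnd ε (step ε h ((v 0).1, (v 0).2.1)) (fun i => v i.succ) := by
  simp only [walkEnd, step, Fin.sum_univ_succ, Prod.mk.injEq, if_false,
    Fin.succ_pos, if_true, Fin.not_lt_zero, Fin.succ_lt_succ_iff, zero_add,
    Finset.sum_sub_distrib, ← Finset.mul_sum]
  refine ⟨by ring, by ring, by ring⟩

@[fun_prop]
lemma continuous_walkEnd (ε : ℝ) (h : H) {k : ℕ} :
    Continuous fun v : Fin k → H => walkEnd ε h v := by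
  unfold walkEnd
  have (i j : Fin k) : Continuous fun v : Fin k → H =>
      if i < j then (v i).1 * (v j).2.1 - (v i).2.1 * (v j).1 else 0 := by
    split_ifs <;> fun_prop
  fun_prop

lemma integral_walkEnd {φ : H → ℝ} (hφ : BddCont φ) (ε : ℝ) (k : ℕ) (h : H) :
    ∫ v, φ (walkEnd ε h v) ∂gaussN k = (walkOp ε)^[k] φ h := by
  induction k generalizing h with
  | zero => simp [walkEnd]
  | succ k ih =>
    obtain ⟨hc, C, hC⟩ := id hφ
    have hstep : Continuous fun ξ => (walkOp ε)^[k] φ (step ε h ξ) :=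
      (hφ.iterate ε k).1.comp (by fun_prop)
    rw [Function.iterate_succ_apply', walkOp, ← measurePreserving_horizontal.map_eq,
      integral_map (by fun_prop) hstep.aestronglyMeasurable]
    have hmp := (measurePreserving_piFinSuccAbove (fun _ : Fin (k + 1) => stdGauss3) 0).symm
    unfold gaussN
    rw [← hmp.integral_comp', integral_prod]
    · refine integral_congr_ae (Filter.Eventually.of_forall fun v => ?_)
      simp only
      rw [← ih]
      refine integral_congr_ae (Filter.Eventually.of_forall fun w => ?_)
      simp only
      rw [walkEnd_succ]
      simp [MeasurableEquiv.piFinSuccAbove_symm_apply, Fin.insertNthEquiv]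
    · refine Integrable.of_bound (C := C) ?_ (Filter.Eventually.of_forall fun _ => hC _)
      exact (((hc.comp (continuous_walkEnd ε h)).measurable).comp
        (MeasurableEquiv.measurable _)).aestronglyMeasurable

lemma integral_walkEnd_rev {φ : H → ℝ} (ε : ℝ) (k : ℕ) :
    ∫ v, φ (walkEnd ε 0 v) ∂gaussN k
      = ∫ v, φ ((walkEnd ε 0 v).1, (walkEnd ε 0 v).2.1, -(walkEnd ε 0 v).2.2) ∂gaussN k := by
  have hmp := measurePreserving_arrowCongr' (fun _ : Fin k => stdGauss3) (fun _ => stdGauss3)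
    Fin.revPerm (MeasurableEquiv.refl H) fun _ => MeasurePreserving.id _
  unfold gaussN
  rw [← hmp.integral_comp']
  refine integral_congr_ae (Filter.Eventually.of_forall fun v => ?_)
  have hv : (MeasurableEquiv.arrowCongr' Fin.revPerm (MeasurableEquiv.refl H)) v
      = fun i => v (Fin.revPerm i) := by
    ext i <;> rfl
  simp only [hv]
  congr 1
  simp only [walkEnd, Equiv.sum_comp Fin.revPerm fun i => (v i).1,
    Equiv.sum_comp Fin.revPerm fun i => (v i).2.1, Prod.mk.injEq, true_and, Prod.fst_zero,
    Prod.snd_zero, zero_mul, sub_zero, mul_zero, zero_add]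
  rw [← mul_neg, ← Finset.sum_neg_distrib]
  congr 1
  rw [Finset.sum_comm, ← Equiv.sum_comp Fin.revPerm]
  refine Finset.sum_congr rfl fun i _ => ?_
  rw [← Equiv.sum_comp Fin.revPerm, ← Finset.sum_neg_distrib]
  refine Finset.sum_congr rfl fun j _ => ?_
  simp only [Fin.revPerm_apply, Fin.rev_rev, Fin.rev_lt_rev]
  split_ifs <;> ring

lemma snk_zero_eq_walkEnd (n : ℕ) (v : Fin n → H) :
    snk 0 n n v = walkEnd ((n : ℝ) ^ (-(1 : ℝ) / 2)) 0 v := by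
  have h2 : ((n : ℝ) ^ (-(1 : ℝ) / 2)) ^ 2 = (n : ℝ)⁻¹ := by
    rw [← Real.rpow_natCast, ← Real.rpow_mul (by positivity), ← Real.rpow_neg_one]
    norm_num
  simp only [snk, walkEnd, Fin.is_lt, if_true, and_true, h2, Prod.fst_zero, Prod.snd_zero,
    zero_mul, sub_zero, mul_zero, zero_add, Fin.lt_def]
  congr 3
  ring

lemma integral_nuMeas {φ : H → ℝ} (hφ : Continuous φ) (n : ℕ) :
    ∫ h, φ h ∂nuMeas 0 n = ∫ v, φ (walkEnd ((n : ℝ) ^ (-(1 : ℝ) / 2)) 0 v) ∂gaussN n := by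
  have : snk 0 n n = fun v => walkEnd ((n : ℝ) ^ (-(1 : ℝ) / 2)) 0 v :=
    funext (snk_zero_eq_walkEnd n)
  rw [nuMeas, this, integral_map (continuous_walkEnd _ _).aemeasurable
    hφ.aestronglyMeasurable]

end WalkLaw

/-! ### Passage to the limit law -/

section LimitLaw

/-- `C¹` functions which are bounded together with their derivatives along the frame. -/
structure FrameBounded (L : ℝ) (f : H → ℝ) : Prop where
  contDiff : ContDiff ℝ 1 f
  bound : ∀ h, |f h| ≤ L
  boundX : ∀ h, |dX f h| ≤ L
  boundY : ∀ h, |dY f h| ≤ L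
  boundZ : ∀ h, |dZ f h| ≤ L

lemma tendsto_walkScale :
    Filter.Tendsto (fun n : ℕ => (n : ℝ) ^ (-(1 : ℝ) / 2)) Filter.atTop (nhds 0) := by
  have := (tendsto_rpow_neg_atTop (y := 1 / 2) (by norm_num)).comp
    (tendsto_natCast_atTop_atTop (R := ℝ))
  simpa [Function.comp_def, neg_div] using this

/-- The measure `γ` is the weak limit of the laws of the rescaled walks. -/
def IsWalkLimit (γ : Measure H) : Prop :=
  ∀ g : BoundedContinuousFunction H ℝ,
    Filter.Tendsto (fun n : ℕ => ∫ h, g h ∂(nuMeas 0 n)) Filter.atTop (nhds (∫ h, g h ∂γ))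

variable {γ : Measure H} {m M L ν : ℝ} {f g φ : H → ℝ}

lemma BddCont.integrable [IsProbabilityMeasure γ] (hφ : BddCont φ) : Integrable φ γ := by
  obtain ⟨hc, C, hC⟩ := hφ
  exact .of_bound hc.aestronglyMeasurable C (Filter.Eventually.of_forall hC)

lemma IsWalkLimit.tendsto_walkEnd (hγ : IsWalkLimit γ) (hφ : BddCont φ) :
    Filter.Tendsto (fun n : ℕ => ∫ v, φ (walkEnd ((n : ℝ) ^ (-(1 : ℝ) / 2)) 0 v) ∂gaussN n)
      Filter.atTop (nhds (∫ h, φ h ∂γ)) := by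
  obtain ⟨hc, C, hC⟩ := hφ
  have := hγ (BoundedContinuousFunction.ofNormedAddCommGroup φ hc C hC)
  simp only [BoundedContinuousFunction.coe_ofNormedAddCommGroup] at this
  simpa only [integral_nuMeas hc] using this

lemma IsWalkLimit.tendsto_iterate (hγ : IsWalkLimit γ) (hφ : BddCont φ) :
    Filter.Tendsto (fun n : ℕ => (walkOp ((n : ℝ) ^ (-(1 : ℝ) / 2)))^[n] φ 0)
      Filter.atTop (nhds (∫ h, φ h ∂γ)) := by
  simpa only [integral_walkEnd hφ] using hγ.tendsto_walkEnd hφ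

lemma IsWalkLimit.integral_reflect (hγ : IsWalkLimit γ) (hφ : BddCont φ) :
    ∫ h, φ (h.1, h.2.1, -h.2.2) ∂γ = ∫ h, φ h ∂γ := by
  have hψ : BddCont fun h => φ (h.1, h.2.1, -h.2.2) := by
    obtain ⟨hc, C, hC⟩ := hφ
    exact ⟨hc.comp (by fun_prop), C, fun h => hC _⟩
  refine tendsto_nhds_unique (hγ.tendsto_walkEnd hψ) ?_
  simpa only [integral_walkEnd_rev (φ := φ)] using hγ.tendsto_walkEnd hφ

lemma IsWalkLimit.entropy_le_of_nice (hγ : IsWalkLimit γ) (hg : Nice m M L g) (hν : 0 < ν) :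
    Ent γ g ≤ ν / 2 * (Real.exp (1 / ν) - 1) *
      (∫ h, hFisher g h ∂γ + ν * ∫ h, vFisher g h ∂γ) := by
  obtain ⟨C, K, -, hle⟩ := hg.walk_entropy_le hν
  have hε := tendsto_walkScale
  have hg1 := hγ.tendsto_iterate hg.bddCont
  have hl := (hγ.tendsto_iterate hg.bddCont_mul_log).sub
    ((Real.continuous_mul_log.tendsto _).comp hg1)
  have hr := (((hγ.tendsto_iterate hg.bddCont_hFisher).add
    ((((tendsto_const_nhds (x := ν)).add (hε.pow 2)).mul
      ((tendsto_const_nhds (x := (1 : ℝ))).add (hε.mul_const K))).mul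
      (hγ.tendsto_iterate hg.bddCont_vFisher))).const_mul
      (ν / 2 * (Real.exp (1 / ν) - 1))).add (hε.const_mul C)
  simp only [zero_mul, mul_zero, add_zero, mul_one, ne_eq, OfNat.ofNat_ne_zero,
    not_false_eq_true, zero_pow] at hr
  refine le_of_tendsto_of_tendsto hl hr ?_
  filter_upwards [Filter.eventually_ge_atTop 1] with n hn
  have hn' : (1 : ℝ) ≤ n := by exact_mod_cast hn
  have hsq : (n : ℝ) * ((n : ℝ) ^ (-(1 : ℝ) / 2)) ^ 2 = 1 := by
    rw [← Real.rpow_natCast, ← Real.rpow_mul (by positivity)]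
    norm_num
    rw [Real.rpow_neg_one, mul_inv_cancel₀ (by positivity)]
  have := hle ((n : ℝ) ^ (-(1 : ℝ) / 2)) n (by positivity)
    (Real.rpow_le_one_of_one_le_of_nonpos hn' (by norm_num)) hsq.le 0
  have herr : (n : ℝ) * (C * ((n : ℝ) ^ (-(1 : ℝ) / 2)) ^ 3)
      = C * (n : ℝ) ^ (-(1 : ℝ) / 2) := by
    linear_combination C * (n : ℝ) ^ (-(1 : ℝ) / 2) * hsq
  rw [herr] at this
  exact this

namespace FrameBounded

lemma fderiv_sq_add (hf : FrameBounded L f) (m : ℝ) (h w : H) :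
    fderiv ℝ (fun h => f h ^ 2 + m) h w = 2 * f h * fderiv ℝ f h w := by
  have hd := ((hf.contDiff.differentiable one_ne_zero) h).hasFDerivAt
  rw [((hd.pow 2).add_const m).fderiv]
  simp

lemma nice_sq_add (hf : FrameBounded L f) (hm : 0 < m) :
    Nice m (L ^ 2 + m) (2 * L * L) (fun h => f h ^ 2 + m) := by
  have key {a b : ℝ} (ha : |a| ≤ L) (hb : |b| ≤ L) : |2 * a * b| ≤ 2 * L * L := by
    rw [abs_mul, abs_mul, abs_two]
    have := (abs_nonneg a).trans ha
    gcongr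
  refine ⟨hm, (hf.contDiff.pow 2).add contDiff_const, fun h => ?_, fun h => ?_,
    fun h => ?_, fun h => ?_, fun h => ?_⟩
  · linarith [sq_nonneg (f h)]
  · linarith [sq_le_sq.2 ((hf.bound h).trans (le_abs_self L))]
  · simpa only [dX, hf.fderiv_sq_add] using key (hf.bound h) (hf.boundX h)
  · simpa only [dY, hf.fderiv_sq_add] using key (hf.bound h) (hf.boundY h)
  · simpa only [dZ, hf.fderiv_sq_add] using key (hf.bound h) (hf.boundZ h)

lemma continuous_fderiv_apply (hf : FrameBounded L f) {w : H → H} (hw : Continuous w) :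
    Continuous fun h => fderiv ℝ f h (w h) :=
  (hf.contDiff.continuous_fderiv one_ne_zero).clm_apply hw

lemma bddCont_dX (hf : FrameBounded L f) : BddCont (dX f) :=
  ⟨hf.continuous_fderiv_apply (by fun_prop), L, hf.boundX⟩

lemma bddCont_dY (hf : FrameBounded L f) : BddCont (dY f) :=
  ⟨hf.continuous_fderiv_apply (by fun_prop), L, hf.boundY⟩

lemma bddCont_dZ (hf : FrameBounded L f) : BddCont (dZ f) :=
  ⟨hf.continuous_fderiv_apply (by fun_prop), L, hf.boundZ⟩

lemma bddCont_energy (hf : FrameBounded L f) (ν : ℝ) :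
    BddCont fun h => dX f h ^ 2 + dY f h ^ 2 + ν * dZ f h ^ 2 := by
  simpa only [← sq] using ((hf.bddCont_dX.mul hf.bddCont_dX).add
    (hf.bddCont_dY.mul hf.bddCont_dY)).add ((hf.bddCont_dZ.mul hf.bddCont_dZ).const_mul ν)

lemma tendsto_ent [IsProbabilityMeasure γ] (hf : FrameBounded L f) :
    Filter.Tendsto (fun n : ℕ => Ent γ fun h => f h ^ 2 + 1 / ((n : ℝ) + 1)) Filter.atTop
      (nhds (Ent γ fun h => f h ^ 2)) := by
  have hc := hf.contDiff.continuous
  have hm := tendsto_one_div_add_atTop_nhds_zero_nat (𝕜 := ℝ)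
  have hmem (n : ℕ) (h : H) : f h ^ 2 + 1 / ((n : ℝ) + 1) ∈ Set.Icc 0 (L ^ 2 + 1) := by
    have h1 := sq_le_sq.2 ((hf.bound h).trans (le_abs_self L))
    have h2 : 1 / ((n : ℝ) + 1) ≤ 1 := by
      rw [div_le_one (by positivity)]
      linarith [Nat.cast_nonneg (α := ℝ) n]
    exact ⟨by positivity, by linarith⟩
  have hlim {F : ℝ → ℝ} (hF : Continuous F) :
      Filter.Tendsto (fun n : ℕ => ∫ h, F (f h ^ 2 + 1 / ((n : ℝ) + 1)) ∂γ) Filter.atTop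
        (nhds (∫ h, F (f h ^ 2) ∂γ)) := by
    obtain ⟨B, hB⟩ := (isCompact_Icc (a := (0 : ℝ)) (b := L ^ 2 + 1)).exists_bound_of_continuousOn
      hF.continuousOn
    refine tendsto_integral_of_dominated_convergence (fun _ => B)
      (fun n => (hF.comp (by fun_prop)).aestronglyMeasurable) (integrable_const _)
      (fun n => Filter.Eventually.of_forall fun h => hB _ (hmem n h))
      (Filter.Eventually.of_forall fun h => ?_)
    have := (hF.tendsto (f h ^ 2 + 0)).comp (hm.const_add (f h ^ 2))
    simpa [Function.comp_def] using this
  have hid := hlim continuous_id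
  exact (hlim Real.continuous_mul_log).sub ((Real.continuous_mul_log.tendsto _).comp hid)

end FrameBounded

lemma sq_two_mul_div_le {a b m : ℝ} (hm : 0 < m) : (2 * a * b) ^ 2 / (a ^ 2 + m) ≤ 4 * b ^ 2 := by
  rw [div_le_iff₀ (by positivity)]
  nlinarith [mul_nonneg (sq_nonneg b) hm.le]

lemma IsWalkLimit.entropy_sq_le [IsProbabilityMeasure γ] (hγ : IsWalkLimit γ)
    (hf : FrameBounded L f) (hν : 0 < ν) :
    Ent γ (fun h => f h ^ 2) ≤ 2 * ν * (Real.exp (1 / ν) - 1) *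
      ∫ h, (dX f h ^ 2 + dY f h ^ 2 + ν * dZ f h ^ 2) ∂γ := by
  refine le_of_tendsto' hf.tendsto_ent fun n => ?_
  have hm : (0 : ℝ) < 1 / ((n : ℝ) + 1) := by positivity
  set m : ℝ := 1 / ((n : ℝ) + 1)
  have hg := hf.nice_sq_add hm
  have hexp : 0 ≤ Real.exp (1 / ν) - 1 := by
    linarith [Real.one_le_exp (x := 1 / ν) (by positivity)]
  refine (hγ.entropy_le_of_nice hg hν).trans ?_
  rw [show 2 * ν * (Real.exp (1 / ν) - 1) = ν / 2 * (Real.exp (1 / ν) - 1) * 4 by ring,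
    mul_assoc _ 4]
  refine mul_le_mul_of_nonneg_left ?_ (by positivity)
  rw [← integral_const_mul, ← integral_const_mul, ← integral_add hg.bddCont_hFisher.integrable
    (hg.bddCont_vFisher.const_mul ν).integrable]
  refine integral_mono (hg.bddCont_hFisher.add (hg.bddCont_vFisher.const_mul ν)).integrable
    ((hf.bddCont_energy ν).const_mul 4).integrable fun h => ?_
  simp only [hFisher, vFisher, dX, dY, dZ, hf.fderiv_sq_add, add_div]
  have hZ := mul_le_mul_of_nonneg_left
    (sq_two_mul_div_le (a := f h) (b := fderiv ℝ f h (0, 0, 1)) hm) hν.le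
  linarith [sq_two_mul_div_le (a := f h) (b := fderiv ℝ f h (1, 0, -h.2.1 / 2)) hm,
    sq_two_mul_div_le (a := f h) (b := fderiv ℝ f h (0, 1, h.1 / 2)) hm]

end LimitLaw

/-! ### Symmetrization -/

section Symmetrization

/-- The reflection `(x, y, z) ↦ (x, y, -z)`. -/
def reflect : H →L[ℝ] H :=
  (ContinuousLinearMap.fst ℝ ℝ (ℝ × ℝ)).prod
    (((ContinuousLinearMap.fst ℝ ℝ ℝ).comp (ContinuousLinearMap.snd ℝ ℝ (ℝ × ℝ))).prod
      (-((ContinuousLinearMap.snd ℝ ℝ ℝ).comp (ContinuousLinearMap.snd ℝ ℝ (ℝ × ℝ)))))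

lemma reflect_apply (h : H) : reflect h = (h.1, h.2.1, -h.2.2) := rfl

lemma reflect_reflect (h : H) : reflect (reflect h) = h := by simp [reflect_apply]

lemma norm_reflect (h : H) : ‖reflect h‖ = ‖h‖ := by simp [reflect_apply, Prod.norm_def]

variable {f : H → ℝ} {A ν : ℝ} {γ : Measure H}

lemma fderiv_comp_reflect (hf : ContDiff ℝ 1 f) (h w : H) :
    fderiv ℝ (fun h => f (reflect h)) h w = fderiv ℝ f (reflect h) (reflect w) := by
  have hd := (hf.differentiable one_ne_zero (reflect h)).hasFDerivAt
  exact congrArg (· w) (hd.comp h reflect.hasFDerivAt).fderiv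

lemma frameBounded_of_decay (hf : ContDiff ℝ 1 f) (hb : ∀ h, |f h| ≤ A)
    (hd : ∀ h w, (1 + ‖h‖) * |fderiv ℝ f h w| ≤ A * ‖w‖) : FrameBounded A f := by
  have key (h w : H) (hw : ‖w‖ ≤ 1 + ‖h‖) : |fderiv ℝ f h w| ≤ A := by
    have hA : 0 ≤ A := (abs_nonneg _).trans (hb h)
    have := (hd h w).trans (mul_le_mul_of_nonneg_left hw hA)
    rw [mul_comm A] at this
    exact le_of_mul_le_mul_left this (by positivity)
  refine ⟨hf, hb, fun h => key h _ ?_, fun h => key h _ ?_, fun h => key h _ ?_⟩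
  · have := abs_snd_le_norm h
    have := norm_nonneg h
    simp only [Prod.norm_def, norm_one, norm_zero, Real.norm_eq_abs, abs_div, abs_neg, abs_two,
      sup_le_iff] at *
    refine ⟨by linarith, by linarith, by linarith [abs_nonneg h.2.1]⟩
  · have := abs_fst_le_norm h
    have := norm_nonneg h
    simp only [Prod.norm_def, norm_one, norm_zero, Real.norm_eq_abs, abs_div, abs_two,
      sup_le_iff] at *
    refine ⟨by linarith, by linarith, by linarith [abs_nonneg h.1]⟩
  · simp [Prod.norm_def]

lemma frameBounded_reflect_of_decay (hf : ContDiff ℝ 1 f) (hb : ∀ h, |f h| ≤ A)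
    (hd : ∀ h w, (1 + ‖h‖) * |fderiv ℝ f h w| ≤ A * ‖w‖) :
    FrameBounded A fun h => f (reflect h) := by
  refine frameBounded_of_decay (hf.comp reflect.contDiff) (fun h => hb _) fun h w => ?_
  have := hd (reflect h) (reflect w)
  rwa [norm_reflect, norm_reflect, ← fderiv_comp_reflect hf] at this

lemma SchwartzMap.exists_fderiv_decay (f : SchwartzMap H ℝ) :
    ∃ A, (∀ h, |f h| ≤ A) ∧ ∀ h w, (1 + ‖h‖) * |fderiv ℝ f h w| ≤ A * ‖w‖ := by
  obtain ⟨C₀, hC₀, h₀⟩ := f.decay 0 0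
  obtain ⟨C₁, hC₁, h₁⟩ := f.decay 0 1
  obtain ⟨C₂, hC₂, h₂⟩ := f.decay 1 1
  simp only [pow_zero, one_mul, norm_iteratedFDeriv_zero, norm_iteratedFDeriv_one, pow_one]
    at h₀ h₁ h₂
  refine ⟨C₀ + C₁ + C₂, fun h => (h₀ h).trans (by linarith), fun h w => ?_⟩
  have hle : |fderiv ℝ f h w| ≤ ‖fderiv ℝ f h‖ * ‖w‖ := (fderiv ℝ f h).le_opNorm w
  calc (1 + ‖h‖) * |fderiv ℝ f h w| ≤ (1 + ‖h‖) * (‖fderiv ℝ f h‖ * ‖w‖) := by gcongr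
    _ = (‖fderiv ℝ f h‖ + ‖h‖ * ‖fderiv ℝ f h‖) * ‖w‖ := by ring
    _ ≤ (C₀ + C₁ + C₂) * ‖w‖ :=
      mul_le_mul_of_nonneg_right (by linarith [h₁ h, h₂ h]) (norm_nonneg w)

lemma pdx_eq_fderiv {h : H} (hf : DifferentiableAt ℝ f h) : pdx f h = fderiv ℝ f h (1, 0, 0) :=
  (hf.hasFDerivAt.comp_hasDerivAt h.1 ((hasDerivAt_id h.1).prodMk
    ((hasDerivAt_const h.1 h.2.1).prodMk (hasDerivAt_const h.1 h.2.2)))).deriv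

lemma pdy_eq_fderiv {h : H} (hf : DifferentiableAt ℝ f h) : pdy f h = fderiv ℝ f h (0, 1, 0) :=
  (hf.hasFDerivAt.comp_hasDerivAt h.2.1 ((hasDerivAt_const h.2.1 h.1).prodMk
    ((hasDerivAt_id h.2.1).prodMk (hasDerivAt_const h.2.1 h.2.2)))).deriv

lemma pdz_eq_fderiv {h : H} (hf : DifferentiableAt ℝ f h) : pdz f h = fderiv ℝ f h (0, 0, 1) :=
  (hf.hasFDerivAt.comp_hasDerivAt h.2.2 ((hasDerivAt_const h.2.2 h.1).prodMk
    ((hasDerivAt_const h.2.2 h.2.1).prodMk (hasDerivAt_id h.2.2)))).deriv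

lemma fderiv_apply_eq_pd {h : H} (hf : DifferentiableAt ℝ f h) (a b c : ℝ) :
    fderiv ℝ f h (a, b, c) = a * pdx f h + b * pdy f h + c * pdz f h := by
  have : ((a, b, c) : H) = a • (1, 0, 0) + b • (0, 1, 0) + c • (0, 0, 1) := by simp
  rw [this, map_add, map_add, map_smul, map_smul, map_smul, pdx_eq_fderiv hf, pdy_eq_fderiv hf,
    pdz_eq_fderiv hf, smul_eq_mul, smul_eq_mul, smul_eq_mul]

/-- The energies of `f` for the left-invariant frame and, after reflection, for the
right-invariant frame average to the weighted energy. -/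
lemma energy_add_energy_reflect (hf : ContDiff ℝ 1 f) (h : H) :
    (dX f h ^ 2 + dY f h ^ 2 + ν * dZ f h ^ 2)
      + (dX (fun h => f (reflect h)) (reflect h) ^ 2 + dY (fun h => f (reflect h)) (reflect h) ^ 2
        + ν * dZ (fun h => f (reflect h)) (reflect h) ^ 2)
      = 2 * (pdx f h ^ 2 + pdy f h ^ 2 + (ν + (h.1 ^ 2 + h.2.1 ^ 2) / 4) * pdz f h ^ 2) := by
  have hd := hf.differentiable one_ne_zero h
  simp only [dX, dY, dZ, fderiv_comp_reflect hf, reflect_reflect]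
  simp only [reflect_apply, fderiv_apply_eq_pd hd]
  ring

end Symmetrization

theorem baudoin_garofalo_lsi_weighted (γ : Measure H) [IsProbabilityMeasure γ]
    (hγ : ∀ g : BoundedContinuousFunction H ℝ,
      Filter.Tendsto (fun n : ℕ => ∫ h, g h ∂(nuMeas 0 n))
        Filter.atTop (nhds (∫ h, g h ∂γ))) :
    ∀ ν : ℝ, 0 < ν → ∀ f : SchwartzMap H ℝ,
      Ent γ (fun h => f h ^ 2) ≤
        2 * ν * (Real.exp (1 / ν) - 1) *
          ∫ h, ((pdx f h) ^ 2 + (pdy f h) ^ 2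
            + (ν + (h.1 ^ 2 + h.2.1 ^ 2) / 4) * (pdz f h) ^ 2) ∂γ := by
  intro ν hν f
  have hγ' : IsWalkLimit γ := hγ
  have hf : ContDiff ℝ 1 f := f.smooth 1
  obtain ⟨A, hb, hd⟩ := f.exists_fderiv_decay
  have hF := frameBounded_of_decay hf hb hd
  have hR := frameBounded_reflect_of_decay hf hb hd
  have hleft := hγ'.entropy_sq_le hF hν
  have hright := hγ'.entropy_sq_le hR hν
  have hER := hR.bddCont_energy ν
  have hsq : BddCont fun h => f h ^ 2 :=
    ⟨hf.continuous.pow 2, A ^ 2, fun h => by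
      rw [abs_pow]
      exact pow_le_pow_left₀ (abs_nonneg _) (hb h) 2⟩
  have hlog : BddCont fun h => f h ^ 2 * Real.log (f h ^ 2) := by
    obtain ⟨B, hB⟩ := (isCompact_Icc (a := -A ^ 2) (b := A ^ 2)).exists_bound_of_continuousOn
      Real.continuous_mul_log.continuousOn
    refine ⟨Real.continuous_mul_log.comp hsq.1, B, fun h => hB _ (abs_le.1 ?_)⟩
    rw [abs_pow]
    exact pow_le_pow_left₀ (abs_nonneg _) (hb h) 2
  have hent : Ent γ (fun h => f (reflect h) ^ 2) = Ent γ fun h => f h ^ 2 := by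
    unfold Ent
    rw [← hγ'.integral_reflect hlog, ← hγ'.integral_reflect hsq]
    rfl
  rw [hent, ← hγ'.integral_reflect hER] at hright
  have hER' : BddCont fun h => dX (fun h => f (reflect h)) (reflect h) ^ 2
      + dY (fun h => f (reflect h)) (reflect h) ^ 2
      + ν * dZ (fun h => f (reflect h)) (reflect h) ^ 2 := by
    obtain ⟨hc, C, hC⟩ := hER
    exact ⟨hc.comp reflect.continuous, C, fun h => hC _⟩
  have hsum := integral_add (hF.bddCont_energy ν).integrable (hER'.integrable (γ := γ))
  simp only [energy_add_energy_reflect hf, integral_const_mul] at hsum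
  simp only [← reflect_apply] at hright
  have := congrArg (2 * ν * (Real.exp (1 / ν) - 1) * ·) hsum
  simp only [mul_add] at this
  linarith

end
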